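/- arXiv:1402.3283 — 2 statements merged into one kernel-verified Lean document; each statement's English description precedes it below -/
import Mathlib

section
/- Fix z ∈ V and for b ∈ ℕ let p_b = Σ_{i∈V} Σ_{η∈Rec(z)} (α_i/κ)·1{av_{i→z}(η) = b} be the stationary probability of an avalanche of burst size b, and let q_b(s_0) = P_{s_0}{ av_{i_τ→z}(ρ_τ) = b } be the probability that the threshold avalanche has burst size b. Then q_b(s_0) → b·p_b as |s_0| → −∞. -/
open scoped BigOperators
open Classical Filter

noncomputable section

namespace ThresholdState

variable {V : Type*} [Fintype V] [DecidableEq V]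

/-- `A i j` is the number of directed edges from `i` to `j`. -/
def outdeg (A : V → V → ℕ) (i : V) : ℕ := ∑ j, A i j

def indeg (A : V → V → ℕ) (i : V) : ℕ := ∑ j, A j i

/-- Eulerian: out-degree equals in-degree at every vertex. -/
def Eulerian (A : V → V → ℕ) : Prop := ∀ i, outdeg A i = indeg A i

/-- (Strongly) connected multigraph. -/
def Connected (A : V → V → ℕ) : Prop :=
  ∀ i j : V, Relation.ReflTransGen (fun a b => 0 < A a b) i j

def deg (A : V → V → ℕ) (i : V) : ℕ := outdeg A i

/-- Graph Laplacian: `Δu(i) = -deg(i)·u(i) + Σ_{e incoming to i} u(e⁻)`. -/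
def lap (A : V → V → ℕ) (u : V → ℤ) (i : V) : ℤ :=
  -(deg A i : ℤ) * u i + ∑ j, (A j i : ℤ) * u j

def delta (z : V) : V → ℤ := fun j => if j = z then 1 else 0

/-- Toppling vertex `i`: replace `s` by `s + Δδ_i`. -/
def toppleAt (A : V → V → ℕ) (s : V → ℤ) (i : V) : V → ℤ :=
  fun j => s j + lap A (delta i) j

def applySeq (A : V → V → ℕ) (s : V → ℤ) (l : List V) : V → ℤ :=
  l.foldl (toppleAt A) s

/-- A legal toppling sequence (avoiding the forbidden set `F`): each toppled
vertex is unstable when toppled and does not lie in `F`. -/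
def ValidSeq (A : V → V → ℕ) (F : V → Prop) : (V → ℤ) → List V → Prop
  | _, [] => True
  | s, i :: l => ¬ F i ∧ (deg A i : ℤ) ≤ s i ∧ ValidSeq A F (toppleAt A s i) l

/-- Stable at every non-forbidden vertex. -/
def StableOff (A : V → V → ℕ) (F : V → Prop) (s : V → ℤ) : Prop :=
  ∀ i, ¬ F i → s i ≤ (deg A i : ℤ) - 1

def StabilizesTo (A : V → V → ℕ) (F : V → Prop) (s : V → ℤ) (l : List V) : Prop :=
  ValidSeq A F s l ∧ StableOff A F (applySeq A s l)

def StabilizableVia (A : V → V → ℕ) (F : V → Prop) (s : V → ℤ) : Prop :=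
  ∃ l, StabilizesTo A F s l

/-- Stabilizable with no forbidden vertices. -/
def Stabilizable (A : V → V → ℕ) (s : V → ℤ) : Prop :=
  StabilizableVia A (fun _ => False) s

def stabSeq (A : V → V → ℕ) (F : V → Prop) (s : V → ℤ) : List V :=
  if h : StabilizableVia A F s then h.choose else []

def stabilizeVia (A : V → V → ℕ) (F : V → Prop) (s : V → ℤ) : V → ℤ :=
  applySeq A s (stabSeq A F s)

/-- Odometer: number of topplings at each vertex (`0` everywhere if not stabilizable). -/
def odometerVia (A : V → V → ℕ) (F : V → Prop) (s : V → ℤ) : V → ℕ :=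
  fun i => (stabSeq A F s).count i

def sinkStabilize (A : V → V → ℕ) (z : V) (s : V → ℤ) : V → ℤ :=
  stabilizeVia A (fun i => i = z) s

def sinkOdometer (A : V → V → ℕ) (z : V) (s : V → ℤ) : V → ℕ :=
  odometerVia A (fun i => i = z) s

/-- `ρ` is `z`-recurrent (Dhar's burning test): `ρ(z) = deg z`, `ρ(i) ≤ deg i - 1`
off the sink, and every site other than `z` topples exactly once in the
stabilization of `ρ + Δδ_z` with sink `z`. -/
def ZRec (A : V → V → ℕ) (z : V) (ρ : V → ℤ) : Prop :=
  ρ z = (deg A z : ℤ) ∧ (∀ i, i ≠ z → ρ i ≤ (deg A i : ℤ) - 1) ∧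
  ∃ l : List V, StabilizesTo A (fun i => i = z) (fun j => ρ j + lap A (delta z) j) l ∧
    ∀ i, i ≠ z → l.count i = 1

/-- `κ` = number of `z`-recurrent sandpiles. -/
def kappa (A : V → V → ℕ) (z : V) : ℕ := Nat.card {ρ : V → ℤ // ZRec A z ρ}

def totalMass (s : V → ℤ) : ℤ := ∑ i, s i

/-- Open addition operator `â_i` (with sink `z`). -/
def openAdd (A : V → V → ℕ) (z i : V) (ρ : V → ℤ) : V → ℤ :=
  fun j => if j = z then (deg A z : ℤ) else sinkStabilize A z (fun k => ρ k + delta i k) j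

/-- `â_i⁻¹` on `Rec(z)`. -/
def openAddInv (A : V → V → ℕ) (z i : V) (ρ : V → ℤ) : V → ℤ :=
  if h : ∃ ρ', ZRec A z ρ' ∧ openAdd A z i ρ' = ρ then h.choose else ρ

/-- Burst size `av_{i→z}(ρ) = |â_i⁻¹ρ| - |ρ| + 1`. -/
def burst (A : V → V → ℕ) (z i : V) (ρ : V → ℤ) : ℤ :=
  totalMass (openAddInv A z i ρ) - totalMass ρ + 1

/-- The `z`-recurrent decomposition `s = ρ + m·δ_z + Δv` with `ρ ∈ Rec(z)`, `v(z)=0`. -/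
def ZDecomp (A : V → V → ℕ) (z : V) (s ρ : V → ℤ) (m : ℤ) (v : V → ℤ) : Prop :=
  ZRec A z ρ ∧ v z = 0 ∧ ∀ j, s j = ρ j + m * delta z j + lap A v j

/-- `R_z(s)`: the `z`-recurrent representative of `s`. -/
def Rz (A : V → V → ℕ) (z : V) (s : V → ℤ) : V → ℤ :=
  if h : ∃ ρ, ∃ m, ∃ v, ZDecomp A z s ρ m v then h.choose else s

/-- `m_z(s)`: the integer in the `z`-recurrent decomposition of `s`. -/
def mz (A : V → V → ℕ) (z : V) (s : V → ℤ) : ℤ :=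
  if h : ∃ m, ∃ ρ, ∃ v, ZDecomp A z s ρ m v then h.choose else 0

/-- Closed addition operator `a_i`. -/
def closedAdd (A : V → V → ℕ) (i : V) (s : V → ℤ) : V → ℤ :=
  if Stabilizable A (fun j => s j + delta i j) then
    stabilizeVia A (fun _ => False) (fun j => s j + delta i j)
  else fun j => s j + delta i j

/-- The closed chain after making the additions listed in `w` (in order). -/
def chain (A : V → V → ℕ) (s0 : V → ℤ) (w : List V) : V → ℤ :=
  w.foldl (fun s i => closedAdd A i s) s0

/-- `w` is a threshold word for `s0`: the chain first becomes non-stabilizable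
exactly after the additions in `w`, i.e. `τ = |w|` on the cylinder of `w`. -/
def IsThresholdWord (A : V → V → ℕ) (s0 : V → ℤ) (w : List V) : Prop :=
  ¬ Stabilizable A (chain A s0 w) ∧
  ∀ w' : List V, w' <+: w → w' ≠ w → Stabilizable A (chain A s0 w')

def wordProb (α : V → ℝ) (w : List V) : ℝ := (w.map α).prod

/-- `P_{s0}(E at the threshold time)`: total probability of the (disjoint)
cylinders of threshold words satisfying `E`. -/
def thresholdProb (A : V → V → ℕ) (α : V → ℝ) (s0 : V → ℤ) (E : List V → Prop) : ℝ :=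
  ∑' w : List V, if IsThresholdWord A s0 w ∧ E w then wordProb α w else 0

/-- `E_{s0}[f at the threshold time]`. -/
def thresholdExp (A : V → V → ℕ) (α : V → ℝ) (s0 : V → ℤ) (f : List V → ℝ) : ℝ :=
  ∑' w : List V, if IsThresholdWord A s0 w then wordProb α w * f w else 0

end ThresholdState

namespace ThresholdState

section Laplacian

variable {V : Type*} [Fintype V] {A : V → V → ℕ} {z : V}

lemma sum_in_eq_deg (hE : Eulerian A) (i : V) : ∑ j, (A j i : ℤ) = deg A i := by
  have h := hE i
  simp only [deg, h, indeg]
  push_cast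
  rfl

lemma lap_zero : lap A 0 = 0 := by
  funext i
  simp [lap]

lemma lap_add (u v : V → ℤ) : lap A (u + v) = lap A u + lap A v := by
  funext i
  simp only [lap, Pi.add_apply, mul_add, Finset.sum_add_distrib]
  ring

lemma lap_smul (c : ℤ) (u : V → ℤ) : lap A (c • u) = c • lap A u := by
  funext i
  simp only [lap, Pi.smul_apply, smul_eq_mul, mul_add, Finset.mul_sum]
  congr 1
  · ring
  · exact Finset.sum_congr rfl fun j _ => by ring

lemma lap_neg (u : V → ℤ) : lap A (-u) = -lap A u := by
  simpa using lap_smul (A := A) (-1) u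

lemma lap_sub (u v : V → ℤ) : lap A (u - v) = lap A u - lap A v := by
  rw [sub_eq_add_neg, lap_add, lap_neg, ← sub_eq_add_neg]

lemma lap_apply_eq_sum_sub (hE : Eulerian A) (u : V → ℤ) (i : V) :
    lap A u i = ∑ j, (A j i : ℤ) * (u j - u i) := by
  simp only [mul_sub, Finset.sum_sub_distrib, ← Finset.sum_mul, sum_in_eq_deg hE, lap]
  ring

lemma lap_const (hE : Eulerian A) (c : ℤ) : lap A (fun _ => c) = 0 := by
  funext i
  simp [lap_apply_eq_sum_sub hE]

lemma totalMass_add (s t : V → ℤ) : totalMass (s + t) = totalMass s + totalMass t := by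
  simp [totalMass, Finset.sum_add_distrib]

lemma totalMass_lap (u : V → ℤ) : totalMass (lap A u) = 0 := by
  simp only [totalMass, lap, Finset.sum_add_distrib]
  rw [Finset.sum_comm, ← Finset.sum_add_distrib]
  refine Finset.sum_eq_zero fun j _ => ?_
  rw [← Finset.sum_mul, deg, outdeg]
  push_cast
  ring

lemma le_sink_of_one_le_lap (hE : Eulerian A) {u : V → ℤ}
    (hu : ∀ i, i ≠ z → 1 ≤ lap A u i) (i : V) : u i ≤ u z := by
  have : Nonempty V := ⟨z⟩
  obtain ⟨k, hk⟩ := Finite.exists_max u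
  by_cases hkz : k = z
  · exact hkz ▸ hk i
  · have h1 := hu k hkz
    rw [lap_apply_eq_sum_sub hE] at h1
    have : ∑ j, (A j k : ℤ) * (u j - u k) ≤ 0 := Finset.sum_nonpos fun j _ =>
      mul_nonpos_of_nonneg_of_nonpos (by positivity) (by linarith [hk j])
    linarith

variable [DecidableEq V]

lemma lap_delta_apply (k i : V) :
    lap A (delta k) i = -(deg A i : ℤ) * (if i = k then 1 else 0) + A k i := by
  simp [lap, delta]

lemma toppleAt_eq (s : V → ℤ) (i : V) : toppleAt A s i = s + lap A (delta i) := rfl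

lemma totalMass_smul_delta (c : ℤ) (i : V) : totalMass (c • delta i) = c := by
  simp [totalMass, delta]

lemma totalMass_delta (i : V) : totalMass (delta i) = 1 := by
  simp [totalMass, delta]

lemma applySeq_eq (s : V → ℤ) (l : List V) :
    applySeq A s l = s + lap A (fun i => (l.count i : ℤ)) := by
  induction l generalizing s with
  | nil => simpa [applySeq, Pi.zero_def] using lap_zero (A := A)
  | cons i l ih =>
    have h : (fun k => ((i :: l).count k : ℤ)) = delta i + fun k => (l.count k : ℤ) := by
      funext k
      simp only [List.count_cons, Pi.add_apply, delta, beq_iff_eq, eq_comm (a := k)]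
      split_ifs <;> push_cast <;> ring
    rw [h, lap_add, ← add_assoc, ← toppleAt_eq, ← ih]
    rfl

/-- The least action principle: a nonnegative `v` such that `s + Δv` is stable bounds the
odometer. -/
lemma exists_stabilizesTo_count_le (F : V → Prop) (n : ℕ) (s v : V → ℤ)
    (hv : ∀ i, 0 ≤ v i) (hn : ∑ i, v i ≤ n) (hs : StableOff A F (s + lap A v)) :
    ∃ l, StabilizesTo A F s l ∧ ∀ i, (l.count i : ℤ) ≤ v i := by
  induction n generalizing s v with
  | zero =>
    have h0 : v = 0 := by
      funext i
      have := Finset.single_le_sum (fun j _ => hv j) (Finset.mem_univ i)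
      have := hv i
      push_cast at hn
      simp only [Pi.zero_apply]
      linarith
    subst h0
    rw [lap_zero, add_zero] at hs
    exact ⟨[], ⟨trivial, hs⟩, by simp⟩
  | succ n ih =>
    by_cases hst : StableOff A F s
    · exact ⟨[], ⟨trivial, hst⟩, by simpa using hv⟩
    · simp only [StableOff, not_forall] at hst
      obtain ⟨i, hiF, hi⟩ := hst
      have hvi : 1 ≤ v i := by
        by_contra hlt
        have h0 : v i = 0 := by have := hv i; omega
        have h1 := hs i hiF
        have h2 : 0 ≤ ∑ j, (A j i : ℤ) * v j :=
          Finset.sum_nonneg fun j _ => mul_nonneg (by positivity) (hv j)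
        simp only [Pi.add_apply, lap, h0] at h1
        linarith
      obtain ⟨l, hl, hc⟩ := ih (toppleAt A s i) (v - delta i)
        (fun j => by
          by_cases h : j = i
          · subst h; simp [delta, hvi]
          · simpa [delta, h] using hv j)
        (by
          have := totalMass_delta i
          simp only [totalMass] at this
          simp only [Pi.sub_apply, Finset.sum_sub_distrib, this]
          push_cast at hn
          linarith)
        (by rwa [toppleAt_eq, lap_sub, add_assoc, add_sub_cancel])
      refine ⟨i :: l, ⟨⟨hiF, by linarith, hl.1⟩, hl.2⟩, fun k => ?_⟩
      have := hc k
      simp only [List.count_cons, beq_iff_eq]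
      simp only [Pi.sub_apply, delta, eq_comm (a := k)] at this
      split_ifs at this ⊢ <;> push_cast <;> linarith

lemma stabilizable_iff_exists_lap (hE : Eulerian A) (s : V → ℤ) :
    Stabilizable A s ↔ ∃ v, ∀ i, (s + lap A v) i ≤ (deg A i : ℤ) - 1 := by
  constructor
  · rintro ⟨l, -, hl⟩
    exact ⟨fun i => (l.count i : ℤ), fun i => by simpa [applySeq_eq] using hl i id⟩
  · rintro ⟨v, hv⟩
    set c : ℤ := ∑ i, |v i|
    have hc : ∀ i, |v i| ≤ c := fun i =>
      Finset.single_le_sum (f := fun i => |v i|) (fun j _ => abs_nonneg _) (Finset.mem_univ i)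
    have hnn : ∀ i, 0 ≤ (v + (fun _ => c) : V → ℤ) i := fun i => by
      have := neg_abs_le (v i)
      have := hc i
      simp only [Pi.add_apply]
      linarith
    obtain ⟨l, hl, -⟩ := exists_stabilizesTo_count_le (A := A) (fun _ => False)
      (∑ i, (v + (fun _ => c) : V → ℤ) i).toNat s (v + fun _ => c) hnn (Int.self_le_toNat _)
      (fun i _ => by rw [lap_add, lap_const hE, add_zero]; exact hv i)
    exact ⟨l, hl⟩

omit [DecidableEq V] in
lemma exists_one_le_lap (hC : Connected A) (z : V) :
    ∃ u : V → ℤ, ∀ i, i ≠ z → 1 ≤ lap A u i := by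
  let P : Finset V → Prop := fun S => z ∈ S ∧ ∃ u : V → ℤ, (∀ j, 0 ≤ u j) ∧
    (∀ j ∈ S, 1 ≤ u j) ∧ (∀ j, j ∉ S → u j = 0) ∧ ∀ j ∈ S, j ≠ z → 1 ≤ lap A u j
  have hz : P {z} := by
    refine ⟨by simp, delta z, fun j => ?_, fun j hj => ?_, fun j hj => ?_, fun j hj hne => ?_⟩
    · unfold delta; split_ifs <;> simp
    · simp [delta, Finset.mem_singleton.1 hj]
    · simp [delta, Finset.mem_singleton.not.1 hj]
    · exact absurd (Finset.mem_singleton.1 hj) hne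
  obtain ⟨S, hS, hmax⟩ := Finset.exists_max_image (Finset.univ.filter P) Finset.card
    ⟨{z}, by simpa using hz⟩
  simp only [Finset.mem_filter, Finset.mem_univ, true_and] at hS hmax
  obtain ⟨hzS, u, hu0, hu1, huS, hu⟩ := hS
  refine ⟨u, fun i hi => hu i ?_ hi⟩
  clear hi
  by_contra hiS
  have hedge : ∃ a b, a ∈ S ∧ b ∉ S ∧ 0 < A a b := by
    by_contra hno
    push Not at hno
    refine hiS ?_
    clear hiS
    have hpath := hC z i
    induction hpath with
    | refl => exact hzS
    | tail _ hab ih =>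
      by_contra hb
      have := hno _ _ ih hb
      omega
  obtain ⟨a, b, ha, hb, hab⟩ := hedge
  have hle : (insert b S).card ≤ S.card := by
    refine hmax _ ⟨Finset.mem_insert_of_mem hzS, ((deg A b : ℤ) + 1) • u + delta b,
      fun j => ?_, fun j hj => ?_, fun j hj => ?_, fun j hj hne => ?_⟩
    · have := hu0 j
      simp only [Pi.add_apply, Pi.smul_apply, smul_eq_mul, delta]
      split_ifs <;> positivity
    · simp only [Pi.add_apply, Pi.smul_apply, smul_eq_mul, delta]
      rcases Finset.mem_insert.1 hj with rfl | h
      · simp [huS j hb]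
      · have := hu1 j h
        have hd : (0 : ℤ) ≤ deg A b := by positivity
        split_ifs <;> nlinarith
    · simp only [Finset.mem_insert, not_or] at hj
      simp [delta, hj.1, huS j hj.2]
    · rw [lap_add, lap_smul]
      simp only [Pi.add_apply, Pi.smul_apply, smul_eq_mul, lap_delta_apply]
      have hd : (0 : ℤ) ≤ deg A b := by positivity
      rcases Finset.mem_insert.1 hj with rfl | h
      · have h1 : 1 ≤ lap A u j := by
          have h2 : (A a j : ℤ) * u a ≤ ∑ k, (A k j : ℤ) * u k :=
            Finset.single_le_sum (f := fun k => (A k j : ℤ) * u k)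
              (fun k _ => mul_nonneg (by positivity) (hu0 k)) (Finset.mem_univ a)
          have h3 := hu1 a ha
          have h4 : (1 : ℤ) ≤ A a j := by exact_mod_cast hab
          simp only [lap, huS j hb]
          nlinarith
        simp only [if_true]
        have : (0 : ℤ) ≤ A j j := by positivity
        nlinarith
      · have h1 := hu j h hne
        have hjb : j ≠ b := fun e => hb (e ▸ h)
        have : (0 : ℤ) ≤ A b j := by positivity
        simp only [if_neg hjb]
        nlinarith
  rw [Finset.card_insert_of_notMem hb] at hle
  omega

lemma stabilizableVia_sink (hE : Eulerian A) (hC : Connected A) (z : V) (s : V → ℤ) :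
    StabilizableVia A (fun i => i = z) s := by
  obtain ⟨u, hu⟩ := exists_one_le_lap hC z
  set c : ℤ := ∑ i, |s i| + 1
  have hc : ∀ i, s i + 1 ≤ c := fun i => by
    have := Finset.single_le_sum (f := fun i => |s i|) (fun j _ => abs_nonneg _)
      (Finset.mem_univ i)
    have := le_abs_self (s i)
    simp only [c]
    linarith
  have hc0 : 0 ≤ c := by positivity
  set v : V → ℤ := c • ((fun _ => u z) - u)
  have hv : ∀ i, 0 ≤ v i := fun i =>
    mul_nonneg hc0 (sub_nonneg.2 (le_sink_of_one_le_lap hE hu i))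
  obtain ⟨l, hl, -⟩ := exists_stabilizesTo_count_le (A := A) (fun i => i = z)
    (∑ i, v i).toNat s v hv (Int.self_le_toNat _) (fun i hi => by
      simp only [v, lap_smul, lap_sub, lap_const hE, Pi.add_apply, Pi.smul_apply, Pi.sub_apply,
        Pi.zero_apply, smul_eq_mul]
      have := hu i hi
      have := hc i
      have : (0 : ℤ) ≤ deg A i := by positivity
      nlinarith)
  exact ⟨l, hl⟩

end Laplacian

end ThresholdState

namespace ThresholdState

section Recurrent

variable {V : Type*} [Fintype V] {A : V → V → ℕ} {z : V}

/-- No nonempty set of non-sink vertices is a forbidden subconfiguration of `s`. -/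
def Burnable (A : V → V → ℕ) (z : V) (s : V → ℤ) : Prop :=
  ∀ X : Finset V, X.Nonempty → z ∉ X → ∃ i ∈ X, ∑ j ∈ X, (A j i : ℤ) ≤ s i

omit [Fintype V] in
lemma Burnable.mono {s t : V → ℤ} (hs : Burnable A z s) (h : ∀ i, i ≠ z → s i ≤ t i) :
    Burnable A z t := fun X hX hz => by
  obtain ⟨i, hi, hle⟩ := hs X hX hz
  exact ⟨i, hi, hle.trans (h i fun e => hz (e ▸ hi))⟩

/-- Maximum principle comparing a stable sandpile with a burnable one. -/
lemma Burnable.le_sink (hE : Eulerian A) {s t v : V → ℤ} (ht : Burnable A z t)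
    (hs : StableOff A (fun i => i = z) s) (h : ∀ i, i ≠ z → t i ≤ s i + lap A v i) (i : V) :
    v i ≤ v z := by
  have : Nonempty V := ⟨z⟩
  obtain ⟨k, hk⟩ := Finite.exists_max v
  refine (hk i).trans ?_
  by_contra! hlt
  obtain ⟨a, ha, hle⟩ := ht (Finset.univ.filter fun j => v j = v k) ⟨k, by simp⟩
    (by simpa using hlt.ne)
  simp only [Finset.mem_filter, Finset.mem_univ, true_and] at ha
  have haz : a ≠ z := fun e => hlt.ne (e ▸ ha)
  have h1 := h a haz
  have h2 := hs a haz
  have h3 : lap A v a ≤ ∑ j, ((if v j = v k then (A j a : ℤ) else 0) - A j a) := by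
    rw [lap_apply_eq_sum_sub hE]
    refine Finset.sum_le_sum fun j _ => ?_
    have hA : (0 : ℤ) ≤ A j a := by positivity
    split_ifs with hj
    · simp [hj, ha]
    · have : v j - v a ≤ -1 := by have := lt_of_le_of_ne (hk j) hj; omega
      nlinarith
  rw [Finset.sum_sub_distrib, sum_in_eq_deg hE, ← Finset.sum_filter] at h3
  linarith

variable [DecidableEq V]

lemma Burnable.toppleAt {s : V → ℤ} (hs : Burnable A z s) {k : V} (hk : (deg A k : ℤ) ≤ s k) :
    Burnable A z (toppleAt A s k) := by
  intro X hX hz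
  simp only [toppleAt_eq, Pi.add_apply, lap_delta_apply]
  have hgain : ∀ i, i ≠ k → s i + (-(deg A i : ℤ) * (if i = k then 1 else 0) + A k i) =
      s i + A k i := fun i hi => by simp [hi]
  by_cases hkX : k ∈ X
  · rcases (X.erase k).eq_empty_or_nonempty with he | hne
    · refine ⟨k, hkX, ?_⟩
      rw [← Finset.add_sum_erase X _ hkX, he]
      simp only [Finset.sum_empty, if_true]
      linarith
    · obtain ⟨i, hi, hle⟩ := hs _ hne fun h => hz (Finset.mem_of_mem_erase h)
      refine ⟨i, Finset.mem_of_mem_erase hi, ?_⟩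
      rw [← Finset.add_sum_erase X _ hkX, hgain i (Finset.ne_of_mem_erase hi)]
      linarith
  · obtain ⟨i, hi, hle⟩ := hs X hX hz
    refine ⟨i, hi, ?_⟩
    rw [hgain i fun e => hkX (e ▸ hi)]
    have : (0 : ℤ) ≤ A k i := by positivity
    linarith

lemma Burnable.applySeq {s : V → ℤ} (hs : Burnable A z s) {F : V → Prop} {l : List V}
    (hl : ValidSeq A F s l) : Burnable A z (applySeq A s l) := by
  induction l generalizing s with
  | nil => exact hs
  | cons i l ih => exact ih (hs.toppleAt hl.2.1) hl.2.2

omit [Fintype V] in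
lemma exists_first_mem {l : List V} {X : Finset V} (h : ∃ i ∈ l, i ∈ X) :
    ∃ l₁ i l₂, l = l₁ ++ i :: l₂ ∧ i ∈ X ∧ ∀ j ∈ l₁, j ∉ X := by
  induction l with
  | nil => simp at h
  | cons a l ih =>
    by_cases ha : a ∈ X
    · exact ⟨[], a, l, rfl, ha, by simp⟩
    · obtain ⟨l₁, i, l₂, rfl, hi, hl⟩ := ih (by simpa [ha] using h)
      exact ⟨a :: l₁, i, l₂, rfl, hi, by simpa [ha] using hl⟩

lemma ValidSeq.deg_le {F : V → Prop} {s : V → ℤ} {l₁ l₂ : List V} {i : V}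
    (h : ValidSeq A F s (l₁ ++ i :: l₂)) : (deg A i : ℤ) ≤ ThresholdState.applySeq A s l₁ i := by
  induction l₁ generalizing s with
  | nil => exact h.2.1
  | cons a l ih => exact ih h.2.2

lemma ValidSeq.notMem {F : V → Prop} {s : V → ℤ} {l : List V}
    (h : ValidSeq A F s l) : ∀ i ∈ l, ¬ F i := by
  induction l generalizing s with
  | nil => simp
  | cons a l ih =>
    simp only [List.mem_cons, forall_eq_or_imp]
    exact ⟨h.1, ih h.2.2⟩

lemma ZRec.burnable (hE : Eulerian A) {ρ : V → ℤ} (h : ZRec A z ρ) : Burnable A z ρ := by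
  obtain ⟨-, -, l, ⟨hl, -⟩, hcount⟩ := h
  intro X ⟨x, hx⟩ hz
  have hxl : x ∈ l := List.one_le_count_iff.1 (hcount x fun e => hz (e ▸ hx)).ge
  obtain ⟨l₁, i, l₂, rfl, hi, hl₁⟩ := exists_first_mem ⟨x, hxl, hx⟩
  refine ⟨i, hi, ?_⟩
  have hzl : z ∉ l₁ ++ i :: l₂ := fun hm => hl.notMem z hm rfl
  have h1 := hl.deg_le
  rw [applySeq_eq] at h1
  change _ ≤ (ρ i + lap A (delta z) i) + lap A _ i at h1
  rw [add_assoc, ← Pi.add_apply (lap A (delta z)), ← lap_add, lap_apply_eq_sum_sub hE] at h1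
  have hci : (delta z i + (l₁.count i : ℤ)) = 0 := by
    have : l₁.count i = 0 := List.count_eq_zero.2 fun hm => hl₁ i hm hi
    have hiz : i ≠ z := fun e => hz (e ▸ hi)
    simp [delta, this, hiz]
  have h2 : ∑ j, (A j i : ℤ) * ((delta z + fun k => (l₁.count k : ℤ)) j -
      (delta z + fun k => (l₁.count k : ℤ)) i) ≤
      ∑ j, ((A j i : ℤ) - if j ∈ X then (A j i : ℤ) else 0) := by
    refine Finset.sum_le_sum fun j _ => ?_
    simp only [Pi.add_apply, hci, sub_zero]
    have hA : (0 : ℤ) ≤ A j i := by positivity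
    split_ifs with hj
    · have : l₁.count j = 0 := List.count_eq_zero.2 fun hm => hl₁ j hm hj
      have hjz : j ≠ z := fun e => hz (e ▸ hj)
      simp [delta, this, hjz]
    · have : delta z j + (l₁.count j : ℤ) ≤ 1 := by
        by_cases hjz : j = z
        · have : l₁.count j = 0 := List.count_eq_zero.2 fun hm =>
            hzl (List.mem_append_left _ (hjz ▸ hm))
          simp [delta, hjz ▸ this, hjz]
        · have h3 := hcount j hjz
          rw [List.count_append] at h3
          simp only [delta, hjz, if_false]
          omega
      nlinarith
  rw [Finset.sum_sub_distrib, sum_in_eq_deg hE, ← Finset.sum_filter, Finset.filter_mem_eq_inter,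
    Finset.univ_inter] at h2
  linarith

lemma zrec_of_burnable (hE : Eulerian A) {ρ : V → ℤ} (hz : ρ z = deg A z)
    (hs : StableOff A (fun i => i = z) ρ) (hb : Burnable A z ρ) : ZRec A z ρ := by
  have h1 : delta z + ((fun _ => 1) - delta z) = fun _ : V => (1 : ℤ) := add_sub_cancel _ _
  obtain ⟨l, hl, hc⟩ := exists_stabilizesTo_count_le (A := A) (fun i => i = z)
    (∑ i, ((fun _ => 1) - delta z : V → ℤ) i).toNat (ρ + lap A (delta z)) ((fun _ => 1) - delta z)
    (fun i => by simp only [Pi.sub_apply, delta]; split_ifs <;> simp) (Int.self_le_toNat _)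
    (by rw [add_assoc, ← lap_add, h1, lap_const hE, add_zero]; exact hs)
  refine ⟨hz, hs, l, hl, fun i hi => le_antisymm ?_ ?_⟩
  · have := hc i
    simp only [Pi.sub_apply, delta, hi, if_false, sub_zero] at this
    exact_mod_cast this
  by_contra! hlt
  obtain ⟨k, hk, hle⟩ := hb (Finset.univ.filter fun j => j ≠ z ∧ l.count j = 0)
    ⟨i, by simp only [Finset.mem_filter, Finset.mem_univ, true_and]; exact ⟨hi, by omega⟩⟩ (by simp)
  simp only [Finset.mem_filter, Finset.mem_univ, true_and] at hk
  have h2 := hl.2 k hk.1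
  rw [applySeq_eq, add_assoc, ← lap_add, Pi.add_apply, lap_apply_eq_sum_sub hE] at h2
  have h3 : ∑ j, ((A j k : ℤ) - if j ≠ z ∧ l.count j = 0 then (A j k : ℤ) else 0) ≤
      ∑ j, (A j k : ℤ) * ((delta z + fun k => (l.count k : ℤ)) j -
      (delta z + fun k => (l.count k : ℤ)) k) := by
    refine Finset.sum_le_sum fun j _ => ?_
    have hA : (0 : ℤ) ≤ A j k := by positivity
    simp only [Pi.add_apply, hk.2, delta, hk.1, if_false]
    split_ifs with hj hjz hjz
    · exact absurd hjz hj.1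
    · simp [hj.2]
    · simp only [Nat.cast_zero, add_zero, sub_zero]
      have : (0 : ℤ) ≤ l.count j := by positivity
      nlinarith
    · have : (1 : ℤ) ≤ l.count j := by
        have : l.count j ≠ 0 := fun h => hj ⟨hjz, h⟩
        omega
      simp only [Nat.cast_zero, add_zero, zero_add, sub_zero]
      nlinarith
  rw [Finset.sum_sub_distrib, sum_in_eq_deg hE, ← Finset.sum_filter] at h3
  linarith

/-- Equality in the sandpile group with sink `z`. -/
def SinkEquiv (A : V → V → ℕ) (z : V) (s t : V → ℤ) : Prop :=
  ∃ (v : V → ℤ) (c : ℤ), t = s + lap A v + c • delta z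

lemma SinkEquiv.refl (s : V → ℤ) : SinkEquiv A z s s := ⟨0, 0, by simp [lap_zero]⟩

lemma SinkEquiv.symm {s t : V → ℤ} (h : SinkEquiv A z s t) : SinkEquiv A z t s := by
  obtain ⟨v, c, rfl⟩ := h
  exact ⟨-v, -c, by rw [lap_neg, neg_smul]; abel⟩

lemma SinkEquiv.trans {s t r : V → ℤ} (h : SinkEquiv A z s t) (h' : SinkEquiv A z t r) :
    SinkEquiv A z s r := by
  obtain ⟨v, c, rfl⟩ := h
  obtain ⟨w, d, rfl⟩ := h'
  exact ⟨v + w, c + d, by rw [lap_add, add_smul]; abel⟩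

lemma SinkEquiv.add_right {s t : V → ℤ} (h : SinkEquiv A z s t) (r : V → ℤ) :
    SinkEquiv A z (s + r) (t + r) := by
  obtain ⟨v, c, rfl⟩ := h
  exact ⟨v, c, by abel⟩

lemma ZRec.eq_of_sinkEquiv (hE : Eulerian A) {ρ σ : V → ℤ} (hρ : ZRec A z ρ) (hσ : ZRec A z σ)
    (h : SinkEquiv A z ρ σ) : ρ = σ := by
  obtain ⟨v, c, hv⟩ := h
  have hv' : ∀ i, i ≠ z → σ i = ρ i + lap A v i := fun i hi => by simp [hv, delta, hi]
  have h1 := (hσ.burnable hE).le_sink hE hρ.2.1 (v := v) fun i hi => (hv' i hi).le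
  have h2 := (hρ.burnable hE).le_sink hE hσ.2.1 (v := -v) fun i hi => by
    rw [lap_neg, hv' i hi, Pi.neg_apply]
    linarith
  have hc : v = fun _ => v z := funext fun i => le_antisymm (h1 i) (neg_le_neg_iff.1 (h2 i))
  funext i
  by_cases hi : i = z
  · rw [hi, hρ.1, hσ.1]
  · rw [hv' i hi, hc, lap_const hE, Pi.zero_apply, add_zero]

lemma zrec_reset_of_stabilizesTo (hE : Eulerian A) {s : V → ℤ} (hb : Burnable A z s) {l : List V}
    (hl : StabilizesTo A (fun i => i = z) s l) :
    ZRec A z (fun j => if j = z then (deg A z : ℤ) else applySeq A s l j) := by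
  refine zrec_of_burnable hE (by simp) (fun i hi => ?_)
    ((hb.applySeq hl.1).mono fun i hi => by simp [hi])
  have hi' : i ≠ z := hi
  simpa [hi'] using hl.2 i hi

lemma sinkEquiv_reset (s : V → ℤ) (l : List V) (c : ℤ) :
    SinkEquiv A z s (fun j => if j = z then c else applySeq A s l j) := by
  refine ⟨fun i => (l.count i : ℤ), c - applySeq A s l z, ?_⟩
  rw [← applySeq_eq]
  funext j
  by_cases hj : j = z
  · simp [hj, delta]
  · simp [hj, delta]

lemma exists_sinkEquiv_zrec (hE : Eulerian A) (hC : Connected A) (z : V) (s : V → ℤ) :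
    ∃ ρ, ZRec A z ρ ∧ SinkEquiv A z s ρ := by
  obtain ⟨u, hu⟩ := exists_one_le_lap hC z
  set c : ℤ := ∑ i, |s i| + ∑ i, (deg A i : ℤ)
  have hb : Burnable A z (s + lap A (c • u)) := by
    intro X ⟨i, hi⟩ hz
    refine ⟨i, hi, ?_⟩
    have h1 : ∑ j ∈ X, (A j i : ℤ) ≤ deg A i := by
      rw [← sum_in_eq_deg hE]
      exact Finset.sum_le_sum_of_subset_of_nonneg (Finset.subset_univ _)
        fun _ _ _ => by positivity
    have h2 := Finset.single_le_sum (f := fun i => |s i|) (fun j _ => abs_nonneg _)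
      (Finset.mem_univ i)
    have h3 := Finset.single_le_sum (f := fun i => (deg A i : ℤ)) (fun j _ => by positivity)
      (Finset.mem_univ i)
    have h4 := neg_abs_le (s i)
    have h5 := hu i fun e => hz (e ▸ hi)
    have hc0 : 0 ≤ c := by positivity
    simp only [lap_smul, Pi.add_apply, Pi.smul_apply, smul_eq_mul]
    nlinarith
  obtain ⟨l, hl⟩ := stabilizableVia_sink hE hC z (s + lap A (c • u))
  exact ⟨_, zrec_reset_of_stabilizesTo hE hb hl,
    SinkEquiv.trans ⟨c • u, 0, by simp⟩ (sinkEquiv_reset _ l _)⟩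

lemma ZRec.nonneg (hE : Eulerian A) {ρ : V → ℤ} (h : ZRec A z ρ) (i : V) : 0 ≤ ρ i := by
  by_cases hi : i = z
  · rw [hi, h.1]
    positivity
  · obtain ⟨j, hj, hle⟩ := h.burnable hE {i} ⟨i, by simp⟩ (by simpa using Ne.symm hi)
    rw [Finset.mem_singleton] at hj
    subst hj
    rw [Finset.sum_singleton] at hle
    exact le_trans (by positivity) hle

lemma finite_zrec (hE : Eulerian A) (z : V) : Finite {ρ : V → ℤ // ZRec A z ρ} := by
  refine Set.Finite.subset (Set.finite_Icc (0 : V → ℤ) fun i => deg A i) fun ρ hρ => ?_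
  refine ⟨ZRec.nonneg hE hρ, fun i => ?_⟩
  by_cases hi : i = z
  · rw [hi, hρ.1]
  · have := hρ.2.1 i hi
    simp only
    linarith

lemma Rz_eq_of_sinkEquiv (hE : Eulerian A) {s ρ : V → ℤ} (hρ : ZRec A z ρ)
    (h : SinkEquiv A z s ρ) : Rz A z s = ρ := by
  have hex : ∃ σ m v, ZDecomp A z s σ m v := by
    obtain ⟨v, c, hv⟩ := h.symm
    refine ⟨ρ, c, v - fun _ => v z, hρ, by simp, fun j => ?_⟩
    rw [lap_sub, lap_const hE, hv]
    simp only [Pi.add_apply, Pi.smul_apply, smul_eq_mul, Pi.sub_apply, Pi.zero_apply]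
    ring
  unfold Rz
  rw [dif_pos hex]
  obtain ⟨m, v, hσ, -, hv⟩ := hex.choose_spec
  refine hσ.eq_of_sinkEquiv hE hρ (SinkEquiv.trans ⟨v, m, ?_⟩ h)
  funext j
  simp only [hv j, Pi.add_apply, Pi.smul_apply, smul_eq_mul]
  ring

lemma stabilizable_iff_totalMass_lt (hE : Eulerian A) {s ρ : V → ℤ} (hρ : ZRec A z ρ)
    (h : SinkEquiv A z s ρ) : Stabilizable A s ↔ totalMass s < totalMass ρ := by
  obtain ⟨v, c, hv⟩ := h
  have hm : totalMass ρ = totalMass s + c := by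
    rw [hv, totalMass_add, totalMass_add, totalMass_lap, totalMass_smul_delta, add_zero]
  rw [stabilizable_iff_exists_lap hE, hm, lt_add_iff_pos_right]
  have hs : ∀ i, s i + lap A v i = ρ i - c * delta z i := fun i => by
    simp only [hv, Pi.add_apply, Pi.smul_apply, smul_eq_mul]
    ring
  constructor
  · rintro ⟨w, hw⟩
    by_contra! hc
    have h1 := (hρ.burnable hE).le_sink hE (s := s + lap A w) (v := v - w)
      (fun i _ => hw i) (fun i hi => by
        have := hs i
        simp only [delta, hi, if_false, mul_zero, sub_zero] at this
        rw [← this, lap_sub, Pi.add_apply, Pi.sub_apply]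
        linarith)
    have h2 : lap A (v - w) z ≤ 0 := by
      rw [lap_apply_eq_sum_sub hE]
      exact Finset.sum_nonpos fun j _ =>
        mul_nonpos_of_nonneg_of_nonpos (by positivity) (by linarith [h1 j])
    have h3 := hw z
    have h4 := hs z
    rw [lap_sub, Pi.sub_apply] at h2
    rw [hρ.1] at h4
    simp only [delta, if_true, mul_one] at h4
    simp only [Pi.add_apply] at h3
    linarith
  · intro hc
    refine ⟨v, fun i => ?_⟩
    rw [Pi.add_apply, hs]
    by_cases hi : i = z
    · simp only [delta, hi, hρ.1, if_true]
      linarith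
    · simpa [delta, hi] using hρ.2.1 i hi

lemma closedAdd_eq (i : V) (s : V → ℤ) :
    ∃ v, closedAdd A i s = s + delta i + lap A v := by
  unfold closedAdd
  split_ifs
  · exact ⟨_, by rw [stabilizeVia, applySeq_eq]; rfl⟩
  · exact ⟨0, by rw [lap_zero, add_zero]; rfl⟩

lemma sinkEquiv_openAdd (i : V) (ρ : V → ℤ) : SinkEquiv A z (ρ + delta i) (openAdd A z i ρ) :=
  sinkEquiv_reset _ _ _

lemma sinkStabilize_spec (hE : Eulerian A) (hC : Connected A) (z : V) (s : V → ℤ) :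
    StabilizesTo A (fun i => i = z) s (stabSeq A (fun i => i = z) s) := by
  rw [stabSeq, dif_pos (stabilizableVia_sink hE hC z s)]
  exact (stabilizableVia_sink hE hC z s).choose_spec

lemma ZRec.openAdd (hE : Eulerian A) (hC : Connected A) (i : V) {ρ : V → ℤ} (h : ZRec A z ρ) :
    ZRec A z (openAdd A z i ρ) :=
  zrec_reset_of_stabilizesTo hE ((h.burnable hE).mono fun j _ => by
    simp only [delta]; split_ifs <;> simp) (sinkStabilize_spec hE hC z _)

lemma totalMass_openAdd_le (hE : Eulerian A) (hC : Connected A) (i : V) {ρ : V → ℤ}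
    (h : ZRec A z ρ) : totalMass (ThresholdState.openAdd A z i ρ) ≤ totalMass ρ + 1 := by
  have hl := sinkStabilize_spec hE hC z (ρ + delta i)
  set l := stabSeq A (fun i => i = z) (ρ + delta i)
  have hle : totalMass (ThresholdState.openAdd A z i ρ) ≤ totalMass (applySeq A (ρ + delta i) l) := by
    refine Finset.sum_le_sum fun j _ => ?_
    simp only [ThresholdState.openAdd]
    split_ifs with hj
    · have hc : l.count z = 0 := List.count_eq_zero.2 fun hm => hl.1.notMem z hm rfl
      have h1 : 0 ≤ delta i z := by unfold delta; split_ifs <;> simp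
      have h2 : 0 ≤ ∑ k, (A k z : ℤ) * (l.count k : ℤ) :=
        Finset.sum_nonneg fun k _ => by positivity
      rw [hj, applySeq_eq]
      simp only [Pi.add_apply, lap, hc, h.1]
      push_cast
      linarith
    · exact le_rfl
  rwa [applySeq_eq, totalMass_add, totalMass_lap, totalMass_add, totalMass_delta, add_zero] at hle

lemma openAdd_injOn (hE : Eulerian A) {i : V} {ρ σ : V → ℤ} (hρ : ZRec A z ρ) (hσ : ZRec A z σ)
    (h : openAdd A z i ρ = openAdd A z i σ) : ρ = σ := by
  refine hρ.eq_of_sinkEquiv hE hσ ?_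
  have h1 := ((sinkEquiv_openAdd (A := A) i ρ).trans
    (h ▸ (sinkEquiv_openAdd (A := A) (z := z) i σ).symm)).add_right (-delta i)
  simpa using h1

lemma burst_openAdd (hE : Eulerian A) (i : V) {ρ : V → ℤ} (hρ : ZRec A z ρ) :
    burst A z i (openAdd A z i ρ) = totalMass ρ - totalMass (openAdd A z i ρ) + 1 := by
  have hex : ∃ σ, ZRec A z σ ∧ openAdd A z i σ = openAdd A z i ρ := ⟨ρ, hρ, rfl⟩
  have : openAddInv A z i (openAdd A z i ρ) = ρ := by
    rw [openAddInv, dif_pos hex]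
    exact openAdd_injOn hE hex.choose_spec.1 hρ hex.choose_spec.2
  rw [burst, this]

/-- The open addition operator as a self-map of the set of recurrent sandpiles. -/
def openStep (hE : Eulerian A) (hC : Connected A) (z i : V) (ρ : {ρ : V → ℤ // ZRec A z ρ}) :
    {ρ : V → ℤ // ZRec A z ρ} :=
  ⟨openAdd A z i ρ.1, ρ.2.openAdd hE hC i⟩

lemma openStep_bijective (hE : Eulerian A) (hC : Connected A) (z i : V) :
    Function.Bijective (openStep hE hC z i) := by
  have := finite_zrec hE z
  exact Finite.injective_iff_bijective.1 fun ρ σ h =>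
    Subtype.ext (openAdd_injOn hE ρ.2 σ.2 (congrArg Subtype.val h))

lemma openStep_sink (hE : Eulerian A) (hC : Connected A) (z : V) (ρ : {ρ : V → ℤ // ZRec A z ρ}) :
    openStep hE hC z z ρ = ρ := by
  refine Subtype.ext ((ρ.2.openAdd hE hC z).eq_of_sinkEquiv hE ρ.2
    ((sinkEquiv_openAdd z ρ.1).symm.trans ⟨0, -1, ?_⟩))
  simp [lap_zero]

/-- The trajectory of `r` under the actions `T i` of the letters of a word. -/
def walk {R : Type*} (T : V → R → R) (r : R) (w : List V) : R := w.foldl (fun r i => T i r) r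

lemma sinkEquiv_walk (hE : Eulerian A) (hC : Connected A) (ρ : {ρ : V → ℤ // ZRec A z ρ})
    (w : List V) :
    SinkEquiv A z (ρ.1 + fun j => (w.count j : ℤ)) (walk (openStep hE hC z) ρ w).1 := by
  induction w generalizing ρ with
  | nil => simpa [walk, ← Pi.zero_def] using SinkEquiv.refl ρ.1
  | cons i w ih =>
    have h : (fun k => ((i :: w).count k : ℤ)) = delta i + fun k => (w.count k : ℤ) := by
      funext k
      simp only [List.count_cons, Pi.add_apply, delta, beq_iff_eq, eq_comm (a := k)]
      split_ifs <;> push_cast <;> ring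
    rw [h, ← add_assoc]
    exact ((sinkEquiv_openAdd i ρ.1).add_right _).trans (ih (openStep hE hC z i ρ))

lemma exists_walk_eq (hE : Eulerian A) (hC : Connected A) (ρ σ : {ρ : V → ℤ // ZRec A z ρ}) :
    ∃ w, walk (openStep hE hC z) ρ w = σ := by
  obtain ⟨u, hu⟩ := exists_one_le_lap hC z
  set c : ℤ := ∑ i, |ρ.1 i|
  set e : V → ℤ := σ.1 + lap A (c • u) - ρ.1
  have he : ∀ i, i ≠ z → 0 ≤ e i := fun i hi => by
    have h1 := Finset.single_le_sum (f := fun i => |ρ.1 i|) (fun j _ => abs_nonneg _)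
      (Finset.mem_univ i)
    have h2 := le_abs_self (ρ.1 i)
    have h3 := hu i hi
    have h4 := σ.2.nonneg hE i
    have hc0 : 0 ≤ c := by positivity
    simp only [e, lap_smul, Pi.sub_apply, Pi.add_apply, Pi.smul_apply, smul_eq_mul]
    nlinarith
  let m : Multiset V := ∑ i, Multiset.replicate (e i).toNat i
  have hm : ∀ j, m.toList.count j = (e j).toNat := fun j => by
    rw [← Multiset.coe_count, Multiset.coe_toList]
    simp [m, Multiset.count_sum', Multiset.count_replicate]
  refine ⟨m.toList, Subtype.ext ((walk (openStep hE hC z) ρ m.toList).2.eq_of_sinkEquiv hE σ.2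
    ((sinkEquiv_walk hE hC ρ m.toList).symm.trans ⟨-(c • u), e z - (e z).toNat, ?_⟩))⟩
  funext j
  simp only [hm, lap_neg, Pi.add_apply, Pi.neg_apply, Pi.smul_apply, smul_eq_mul]
  have hj : e j = σ.1 j + lap A (c • u) j - ρ.1 j := rfl
  by_cases hjz : j = z
  · subst hjz
    simp only [delta, if_true]
    linarith
  · rw [Int.toNat_of_nonneg (he j hjz)]
    simp only [delta, hjz, if_false]
    linarith

end Recurrent

end ThresholdState

namespace ThresholdState

section Averaging

variable {V R : Type*} [Fintype V]

/-- The transition operator of the random walk on `R` whose steps are the maps `T i`, chosen with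
probability `α i`. -/
def avgOp (α : V → ℝ) (T : V → R → R) : Module.End ℝ (R → ℝ) where
  toFun f r := ∑ i, α i * f (T i r)
  map_add' f g := by
    funext r
    simp [mul_add, Finset.sum_add_distrib]
  map_smul' c f := by
    funext r
    simp only [Pi.smul_apply, smul_eq_mul, RingHom.id_apply, Finset.mul_sum]
    exact Finset.sum_congr rfl fun i _ => by ring

variable {α : V → ℝ} {T : V → R → R}

lemma avgOp_apply (f : R → ℝ) (r : R) : avgOp α T f r = ∑ i, α i * f (T i r) := rfl

lemma avgOp_pow_succ_apply' (n : ℕ) (f : R → ℝ) :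
    (avgOp α T ^ (n + 1)) f = avgOp α T ((avgOp α T ^ n) f) := by
  rw [pow_succ', Module.End.mul_apply]

lemma avgOp_pow_succ_apply (n : ℕ) (f : R → ℝ) :
    (avgOp α T ^ (n + 1)) f = (avgOp α T ^ n) (avgOp α T f) := by
  rw [pow_succ, Module.End.mul_apply]

lemma avgOp_pow_nonneg (hα : ∀ i, 0 < α i) (n : ℕ) {f : R → ℝ} (hf : 0 ≤ f) :
    0 ≤ (avgOp α T ^ n) f := by
  induction n with
  | zero => simpa
  | succ n ih =>
    rw [avgOp_pow_succ_apply']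
    exact fun r => Finset.sum_nonneg fun i _ => mul_nonneg (hα i).le (ih _)

lemma avgOp_pow_const (hsum : ∑ i, α i = 1) (n : ℕ) (c : ℝ) :
    (avgOp α T ^ n) (fun _ => c) = fun _ => c := by
  induction n with
  | zero => simp
  | succ n ih =>
    rw [avgOp_pow_succ_apply', ih]
    funext r
    rw [avgOp_apply, ← Finset.sum_mul, hsum, one_mul]

omit [Fintype V] in
lemma wordProb_pos (hα : ∀ i, 0 < α i) (w : List V) : 0 < wordProb α w := by
  refine List.prod_pos fun x hx => ?_
  obtain ⟨i, -, rfl⟩ := List.mem_map.1 hx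
  exact hα i

lemma wordProb_mul_le (hα : ∀ i, 0 < α i) {f : R → ℝ} (hf : 0 ≤ f) (w : List V) (r : R) :
    wordProb α w * f (walk T r w) ≤ (avgOp α T ^ w.length) f r := by
  induction w generalizing r with
  | nil => simp [wordProb, walk]
  | cons i w ih =>
    rw [List.length_cons, avgOp_pow_succ_apply', avgOp_apply]
    refine le_trans ?_ (Finset.single_le_sum (f := fun i => α i * (avgOp α T ^ w.length) f (T i r))
      (fun j _ => mul_nonneg (hα j).le (avgOp_pow_nonneg hα _ hf _)) (Finset.mem_univ i))
    have h1 : wordProb α (i :: w) = α i * wordProb α w := by simp [wordProb]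
    rw [h1, mul_assoc]
    exact mul_le_mul_of_nonneg_left (ih (T i r)) (hα i).le

variable [Fintype R]

lemma sum_avgOp_pow (hsum : ∑ i, α i = 1) (hT : ∀ i, Function.Bijective (T i)) (n : ℕ)
    (f : R → ℝ) : ∑ r, (avgOp α T ^ n) f r = ∑ r, f r := by
  induction n with
  | zero => simp
  | succ n ih =>
    rw [avgOp_pow_succ_apply', ← ih]
    simp only [avgOp_apply]
    rw [Finset.sum_comm]
    simp only [← Finset.mul_sum]
    rw [Finset.sum_congr rfl fun i _ => by rw [(hT i).sum_comp ((avgOp α T ^ n) f)],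
      ← Finset.sum_mul, hsum, one_mul]

lemma exists_minorization (hα : ∀ i, 0 < α i) {z : V} (hz : ∀ r, T z r = r)
    (htrans : ∀ r r', ∃ w, walk T r w = r') :
    ∃ N : ℕ, ∃ c : ℝ, 0 < c ∧ ∀ f : R → ℝ, 0 ≤ f → ∀ r r', c * f r' ≤ (avgOp α T ^ N) f r := by
  choose W hW using htrans
  set N := ∑ p : R × R, (W p.1 p.2).length
  have hN : ∀ r r', (W r r').length ≤ N := fun r r' =>
    Finset.single_le_sum (f := fun p : R × R => (W p.1 p.2).length) (fun _ _ => Nat.zero_le _)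
      (Finset.mem_univ (r, r'))
  let W' : R → R → List V := fun r r' => List.replicate (N - (W r r').length) z ++ W r r'
  have hlen : ∀ r r', (W' r r').length = N := fun r r' => by
    have := hN r r'
    simp only [W', List.length_append, List.length_replicate]
    omega
  have hrep : ∀ k r, walk T r (List.replicate k z) = r := fun k r => by
    induction k with
    | zero => rfl
    | succ k ih => simpa [walk, List.replicate_succ, hz] using ih
  have hwalk : ∀ r r', walk T r (W' r r') = r' := fun r r' => by
    conv_rhs => rw [← hW r r']
    simp only [W', walk, List.foldl_append]
    congr 1
    exact hrep _ r
  rcases isEmpty_or_nonempty R with hR | hR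
  · exact ⟨0, 1, one_pos, fun f _ r => isEmptyElim r⟩
  obtain ⟨p, hp⟩ := Finite.exists_min fun p : R × R => wordProb α (W' p.1 p.2)
  refine ⟨N, wordProb α (W' p.1 p.2), wordProb_pos hα _, fun f hf r r' => ?_⟩
  have h1 := wordProb_mul_le (T := T) hα hf (W' r r') r
  rw [hlen, hwalk] at h1
  exact (mul_le_mul_of_nonneg_right (hp (r, r')) (hf r')).trans h1

lemma abs_avgOp_pow_le (n : ℕ) (f : R → ℝ) (r : R) (c : ℝ)
    (h : ∀ g : R → ℝ, 0 ≤ g → c * ∑ r, g r ≤ (avgOp α T ^ n) g r) (hf : ∑ r, f r = 0) :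
    |(avgOp α T ^ n) f r| ≤ (avgOp α T ^ n) (fun r => |f r|) r - c * ∑ r, |f r| := by
  have h1 := h ((fun r => |f r|) - f) fun r => sub_nonneg.2 (le_abs_self (f r))
  have h2 := h ((fun r => |f r|) + f) fun r => by
    have := neg_abs_le (f r)
    simp only [Pi.zero_apply, Pi.add_apply]
    linarith
  rw [map_sub] at h1
  rw [map_add] at h2
  simp only [Pi.sub_apply, Pi.add_apply, Finset.sum_sub_distrib, Finset.sum_add_distrib, hf,
    sub_zero, add_zero] at h1 h2
  rw [abs_le]
  constructor <;> linarith

theorem tendsto_avgOp_pow (hα : ∀ i, 0 < α i) (hsum : ∑ i, α i = 1)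
    (hT : ∀ i, Function.Bijective (T i)) {z : V} (hz : ∀ r, T z r = r)
    (htrans : ∀ r r', ∃ w, walk T r w = r') (f : R → ℝ) (r : R) :
    Tendsto (fun n => (avgOp α T ^ n) f r) atTop (nhds ((∑ r, f r) / Fintype.card R)) := by
  have hR : Nonempty R := ⟨r⟩
  have hcard : (0 : ℝ) < Fintype.card R := by exact_mod_cast Fintype.card_pos
  obtain ⟨N, c, hc, hmin⟩ := exists_minorization hα hz htrans
  set a := (∑ r, f r) / Fintype.card R
  set g : R → ℝ := f - fun _ => a
  have hg : ∑ r, g r = 0 := by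
    simp only [g, a, Pi.sub_apply, Finset.sum_sub_distrib, Finset.sum_const, Finset.card_univ,
      nsmul_eq_mul]
    field_simp
    ring
  have hgn : ∀ n, ∑ r, (avgOp α T ^ n) g r = 0 := fun n => by rw [sum_avgOp_pow hsum hT, hg]
  let x : ℕ → ℝ := fun n => ∑ r, |(avgOp α T ^ n) g r|
  have hx0 : ∀ n, 0 ≤ x n := fun n => Finset.sum_nonneg fun _ _ => abs_nonneg _
  have hanti : Antitone x := antitone_nat_of_succ_le fun n => by
    have h1 : ∀ r, |(avgOp α T ^ (n + 1)) g r| ≤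
        (avgOp α T ^ 1) (fun r => |(avgOp α T ^ n) g r|) r := fun r => by
      have := abs_avgOp_pow_le (α := α) (T := T) 1 ((avgOp α T ^ n) g) r 0
        (fun g hg => by rw [zero_mul]; exact avgOp_pow_nonneg hα 1 hg r) (hgn n)
      rwa [zero_mul, sub_zero, ← Module.End.mul_apply, ← pow_add, add_comm 1 n] at this
    exact (Finset.sum_le_sum fun r _ => h1 r).trans_eq (sum_avgOp_pow hsum hT 1 _)
  have hcontr : ∀ n, x (n + N) ≤ (1 - c) * x n := fun n => by
    have h1 : ∀ r, |(avgOp α T ^ (n + N)) g r| ≤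
        (avgOp α T ^ N) (fun r => |(avgOp α T ^ n) g r|) r - c / Fintype.card R * x n := fun r => by
      have := abs_avgOp_pow_le (α := α) (T := T) N ((avgOp α T ^ n) g) r (c / Fintype.card R)
        (fun g hg => by
          have h2 := Finset.sum_le_sum fun r' (_ : r' ∈ Finset.univ) => hmin g hg r r'
          rw [← Finset.mul_sum, Finset.sum_const, Finset.card_univ, nsmul_eq_mul] at h2
          rw [div_mul_eq_mul_div, div_le_iff₀ hcard]
          linarith) (hgn n)
      rwa [← Module.End.mul_apply, ← pow_add, add_comm N n] at this
    refine (Finset.sum_le_sum fun r _ => h1 r).trans_eq ?_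
    rw [Finset.sum_sub_distrib, sum_avgOp_pow hsum hT, Finset.sum_const, Finset.card_univ,
      nsmul_eq_mul]
    simp only [x]
    field_simp
  have hlim := tendsto_atTop_ciInf hanti ⟨0, by rintro _ ⟨n, rfl⟩; exact hx0 n⟩
  set L := ⨅ n, x n
  have hL0 : 0 ≤ L := ge_of_tendsto' hlim hx0
  have hL : L ≤ (1 - c) * L :=
    le_of_tendsto_of_tendsto' (hlim.comp (tendsto_add_atTop_nat N)) (hlim.const_mul (1 - c)) hcontr
  have hL' : L = 0 := by nlinarith
  rw [hL'] at hlim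
  have h3 : Tendsto (fun n => (avgOp α T ^ n) g r) atTop (nhds 0) :=
    squeeze_zero_norm (fun n => Finset.single_le_sum (f := fun r => |(avgOp α T ^ n) g r|)
      (fun _ _ => abs_nonneg _) (Finset.mem_univ r)) hlim
  have h4 : ∀ n, (avgOp α T ^ n) f r = (avgOp α T ^ n) g r + a := fun n => by
    simp only [g, map_sub, avgOp_pow_const hsum, Pi.sub_apply]
    ring
  simp only [h4]
  simpa using h3.add_const a

omit [Fintype R] in
lemma hasSum_of_hasSum_concat {F : List V → ℝ} {a : V → ℝ} (h0 : F [] = 0)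
    (h : ∀ i, HasSum (fun w => F (w ++ [i])) (a i)) : HasSum F (∑ i, a i) := by
  have h1 : ∀ i, HasSum (fun w : List V => if w.getLast? = some i then F w else 0) (a i) := by
    intro i
    have hinj : Function.Injective fun w : List V => w ++ [i] := fun _ _ h =>
      List.append_cancel_right h
    refine (hinj.hasSum_iff fun w hw => if_neg fun hl => hw ?_).1 ?_
    · obtain ⟨l, rfl⟩ := List.getLast?_eq_some_iff.1 hl
      exact ⟨l, rfl⟩
    · simpa [Function.comp_def] using h i
  convert hasSum_sum fun i (_ : i ∈ Finset.univ) => h1 i using 1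
  funext w
  rcases List.eq_nil_or_concat w with rfl | ⟨l, i, rfl⟩
  · simp [h0]
  · simp [List.concat_eq_append]

omit [Fintype R] in
lemma hasSum_walk (f : R → ℝ) (n : ℕ) (r : R) :
    HasSum (fun w : List V => if w.length = n then wordProb α w * f (walk T r w) else 0)
      ((avgOp α T ^ n) f r) := by
  induction n generalizing f with
  | zero =>
    convert hasSum_ite_eq ([] : List V) (f r) using 1
    · funext w
      rcases w with _ | ⟨i, w⟩ <;> simp [wordProb, walk]
    · simp
  | succ n ih =>
    have h1 : (avgOp α T ^ (n + 1)) f = ∑ i, (avgOp α T ^ n) (fun r => α i * f (T i r)) := by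
      rw [avgOp_pow_succ_apply, ← map_sum]
      congr 1
      funext r
      simp [avgOp_apply]
    rw [h1, Finset.sum_apply]
    refine hasSum_of_hasSum_concat (by simp) fun i => ?_
    convert ih (fun r => α i * f (T i r)) using 1
    funext w
    simp [wordProb, walk, mul_assoc]

end Averaging

end ThresholdState

namespace ThresholdState

section Threshold

variable {V : Type*} [Fintype V] [DecidableEq V] {A : V → V → ℕ} {z : V}

lemma chain_concat (s : V → ℤ) (w : List V) (i : V) :
    chain A s (w ++ [i]) = closedAdd A i (chain A s w) := by
  simp [chain]

omit [Fintype V] [DecidableEq V] in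
lemma walk_concat {R : Type*} (T : V → R → R) (r : R) (w : List V) (i : V) :
    walk T r (w ++ [i]) = T i (walk T r w) := by
  simp [walk]

lemma totalMass_chain (s : V → ℤ) (w : List V) :
    totalMass (chain A s w) = totalMass s + w.length := by
  induction w using List.reverseRecOn with
  | nil => simp [chain]
  | append_singleton w i ih =>
    obtain ⟨v, hv⟩ := closedAdd_eq (A := A) i (chain A s w)
    rw [chain_concat, hv, totalMass_add, totalMass_add, totalMass_lap, totalMass_delta, ih]
    simp only [List.length_append, List.length_singleton]
    push_cast
    ring

lemma sinkEquiv_chain (hE : Eulerian A) (hC : Connected A) {s : V → ℤ}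
    {ρ : {ρ : V → ℤ // ZRec A z ρ}} (h : SinkEquiv A z s ρ.1) (w : List V) :
    SinkEquiv A z (chain A s w) (walk (openStep hE hC z) ρ w).1 := by
  induction w using List.reverseRecOn with
  | nil => exact h
  | append_singleton w i ih =>
    obtain ⟨v, hv⟩ := closedAdd_eq (A := A) i (chain A s w)
    rw [chain_concat, walk_concat, hv]
    exact (SinkEquiv.symm ⟨v, 0, by simp⟩).trans ((ih.add_right _).trans (sinkEquiv_openAdd i _))

lemma stabilizable_chain_iff (hE : Eulerian A) (hC : Connected A) {s : V → ℤ}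
    {ρ : {ρ : V → ℤ // ZRec A z ρ}} (h : SinkEquiv A z s ρ.1) (w : List V) :
    Stabilizable A (chain A s w) ↔
      totalMass s + w.length < totalMass (walk (openStep hE hC z) ρ w).1 := by
  rw [stabilizable_iff_totalMass_lt hE (walk (openStep hE hC z) ρ w).2
    (sinkEquiv_chain hE hC h w), totalMass_chain]

lemma stabilizable_chain_of_prefix (hE : Eulerian A) (hC : Connected A) {s : V → ℤ}
    {ρ : {ρ : V → ℤ // ZRec A z ρ}} (h : SinkEquiv A z s ρ.1) {w w' : List V} (hw : w' <+: w)
    (hst : Stabilizable A (chain A s w)) : Stabilizable A (chain A s w') := by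
  obtain ⟨t, rfl⟩ := hw
  induction t using List.reverseRecOn with
  | nil => simpa using hst
  | append_singleton t i ih =>
    refine ih ?_
    rw [← List.append_assoc, stabilizable_chain_iff hE hC h, walk_concat] at hst
    rw [stabilizable_chain_iff hE hC h]
    have := totalMass_openAdd_le hE hC i (walk (openStep hE hC z) ρ (w' ++ t)).2
    simp only [openStep, List.length_append, List.length_singleton] at hst this ⊢
    push_cast at hst ⊢
    linarith

lemma isThresholdWord_concat_iff (hE : Eulerian A) (hC : Connected A) {s : V → ℤ}
    {ρ : {ρ : V → ℤ // ZRec A z ρ}} (h : SinkEquiv A z s ρ.1) (w : List V) (i : V) :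
    IsThresholdWord A s (w ++ [i]) ↔
      totalMass s + w.length < totalMass (walk (openStep hE hC z) ρ w).1 ∧
      totalMass (openAdd A z i (walk (openStep hE hC z) ρ w).1) ≤ totalMass s + w.length + 1 := by
  have h1 : ¬ Stabilizable A (chain A s (w ++ [i])) ↔
      totalMass (openAdd A z i (walk (openStep hE hC z) ρ w).1) ≤ totalMass s + w.length + 1 := by
    rw [stabilizable_chain_iff hE hC h, walk_concat, not_lt]
    simp only [openStep, List.length_append, List.length_singleton]
    push_cast
    rw [add_assoc]
  rw [IsThresholdWord, h1, ← stabilizable_chain_iff hE hC h, and_comm]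
  refine and_congr_left fun _ => ⟨fun H => H w ⟨[i], rfl⟩ (by simp), fun H w' hw' hne => ?_⟩
  rcases List.prefix_concat_iff.1 hw' with h2 | h2
  · exact absurd h2 hne
  · exact stabilizable_chain_of_prefix hE hC h h2 H

/-- The recurrent state just before the threshold is `ρ`, and the last addition, at `i`, causes an
avalanche of burst size `b`. -/
def burstWeight (hE : Eulerian A) (hC : Connected A) (α : V → ℝ) (z : V) (b : ℕ) (i : V)
    (ρ σ : {ρ : V → ℤ // ZRec A z ρ}) : ℝ :=
  if σ = ρ ∧ burst A z i (openStep hE hC z i ρ).1 = (b : ℤ) then α i else 0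

/-- The threshold probability of burst size `b` in terms of the open chain: the crossing jump of
size `b` starts at one of the levels `-1, …, -b`, and the level and the recurrent state determine
the time. -/
lemma thresholdProb_burst_eq (hE : Eulerian A) (hC : Connected A) (α : V → ℝ) (b : ℕ)
    [Fintype {ρ : V → ℤ // ZRec A z ρ}] {s : V → ℤ} {ρ₀ : {ρ : V → ℤ // ZRec A z ρ}}
    (h : SinkEquiv A z s ρ₀.1) (hs : totalMass s + b ≤ 0) :
    thresholdProb A α s (fun w => ∃ i : V, w.getLast? = some i ∧
        burst A z i (Rz A z (chain A s w)) = (b : ℤ)) =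
      ∑ i, ∑ j ∈ Finset.Icc 1 b, ∑ ρ : {ρ : V → ℤ // ZRec A z ρ},
        (avgOp α (openStep hE hC z) ^ (totalMass ρ.1 - totalMass s - j).toNat)
          (burstWeight hE hC α z b i ρ) ρ₀ := by
  refine (hasSum_of_hasSum_concat (by simp) fun i => ?_).tsum_eq
  have hsum := hasSum_sum fun j (_ : j ∈ Finset.Icc 1 b) =>
    hasSum_sum fun ρ (_ : ρ ∈ (Finset.univ : Finset {ρ : V → ℤ // ZRec A z ρ})) =>
      hasSum_walk (α := α) (T := openStep hE hC z) (burstWeight hE hC α z b i ρ)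
        (totalMass ρ.1 - totalMass s - j).toNat ρ₀
  convert hsum using 1
  funext w
  set σ := walk (openStep hE hC z) ρ₀ w with hσ
  have hR : Rz A z (chain A s (w ++ [i])) = (openStep hE hC z i σ).1 := by
    refine Rz_eq_of_sinkEquiv hE (openStep hE hC z i σ).2 ?_
    rw [hσ, ← walk_concat (openStep hE hC z)]
    exact sinkEquiv_chain hE hC h _
  have hb := burst_openAdd hE i σ.2
  have hmass : 0 ≤ totalMass σ.1 := Finset.sum_nonneg fun j _ => σ.2.nonneg hE j
  have hinner : ∀ j ∈ Finset.Icc 1 b, (∑ ρ : {ρ : V → ℤ // ZRec A z ρ},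
      if w.length = (totalMass ρ.1 - totalMass s - (j : ℤ)).toNat then
        wordProb α w * burstWeight hE hC α z b i ρ σ else 0) =
      if (j : ℤ) = totalMass σ.1 - totalMass s - w.length then
        wordProb α w * burstWeight hE hC α z b i σ σ else 0 := by
    intro j hj
    rw [Finset.sum_eq_single σ]
    · have hj2 := (Finset.mem_Icc.1 hj).2
      refine if_congr ?_ rfl rfl
      omega
    · intro ρ _ hne
      simp [burstWeight, hne.symm]
    · simp
  rw [Finset.sum_congr rfl hinner]
  have hprob : wordProb α (w ++ [i]) = wordProb α w * α i := by simp [wordProb]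
  simp only [List.getLast?_append, List.getLast?_singleton, Option.some_or, Option.some.injEq,
    exists_eq_left', hR, isThresholdWord_concat_iff hE hC h, ← hσ, hprob]
  by_cases hbi : burst A z i (openStep hE hC z i σ).1 = (b : ℤ)
  · have hb' : (b : ℤ) = totalMass σ.1 - totalMass (openAdd A z i σ.1) + 1 := by
      rw [← hbi, ← hb]; rfl
    simp only [burstWeight, hbi, and_self, if_true, and_true]
    by_cases hc : totalMass s + w.length < totalMass σ.1 ∧
        totalMass (openAdd A z i σ.1) ≤ totalMass s + w.length + 1
    · rw [if_pos hc, Finset.sum_eq_single (totalMass σ.1 - totalMass s - w.length).toNat]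
      · rw [if_pos (by omega)]
      · intro j _ hj
        exact if_neg (by omega)
      · intro hj
        refine absurd (Finset.mem_Icc.2 ⟨?_, ?_⟩) hj <;> omega
    · rw [if_neg hc, Finset.sum_eq_zero]
      intro j hj
      have := Finset.mem_Icc.1 hj
      exact if_neg (by omega)
  · simp [burstWeight, hbi]

end Threshold

end ThresholdState

open ThresholdState in
/-- Size-biasing of the burst size: `q_b(s₀) → b·p_b` as `|s₀| → -∞`, where
`p_b` is the stationary probability of an avalanche of burst size `b` and
`q_b(s₀)` is the probability that the threshold avalanche has burst size `b`. -/
theorem statement_6 {V : Type*} [Fintype V] [DecidableEq V]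
    (A : V → V → ℕ) (hEul : Eulerian A) (hConn : Connected A)
    (α : V → ℝ) (hαpos : ∀ j, 0 < α j) (hαsum : ∑ j, α j = 1)
    (z : V) (b : ℕ) :
    ∀ ε : ℝ, 0 < ε → ∃ K : ℤ, K < 0 ∧ ∀ s0 : V → ℤ, totalMass s0 < K →
      |thresholdProb A α s0
          (fun w => ∃ i : V, w.getLast? = some i ∧
            burst A z i (Rz A z (chain A s0 w)) = (b : ℤ))
        - (b : ℝ) *
            ∑ i : V, ∑' η : {η : V → ℤ // ZRec A z η},
              (α i / (kappa A z : ℝ)) * (if burst A z i η.1 = (b : ℤ) then 1 else 0)|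
      ≤ ε := by
  have hfin := finite_zrec hEul z
  let _ : Fintype {ρ : V → ℤ // ZRec A z ρ} := Fintype.ofFinite _
  set κ : ℝ := (Fintype.card {ρ : V → ℤ // ZRec A z ρ} : ℝ)
  have hκ : (kappa A z : ℝ) = κ := by rw [kappa, Nat.card_eq_fintype_card]
  let wt := burstWeight hEul hConn α z b
  have hlim : ∀ i ρ ρ₀, Tendsto
      (fun n => (avgOp α (openStep hEul hConn z) ^ n) (wt i ρ) ρ₀) atTop
      (nhds ((∑ σ, wt i ρ σ) / κ)) := fun i ρ ρ₀ =>
    tendsto_avgOp_pow hαpos hαsum (openStep_bijective hEul hConn z) (openStep_sink hEul hConn z)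
      (exists_walk_eq hEul hConn) _ _
  have htarget : (b : ℝ) * ∑ i : V, ∑' η : {η : V → ℤ // ZRec A z η},
      (α i / (kappa A z : ℝ)) * (if burst A z i η.1 = (b : ℤ) then 1 else 0) =
      ∑ i, ∑ j ∈ Finset.Icc 1 b, ∑ ρ, (∑ σ, wt i ρ σ) / κ := by
    simp only [Finset.sum_const, Nat.card_Icc, add_tsub_cancel_right, nsmul_eq_mul,
      ← Finset.mul_sum]
    congr 1
    refine Finset.sum_congr rfl fun i _ => ?_
    rw [tsum_fintype, ← (openStep_bijective hEul hConn z i).sum_comp]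
    refine Finset.sum_congr rfl fun ρ _ => ?_
    rw [hκ, Finset.sum_eq_single ρ (fun σ _ hσ => by simp [wt, burstWeight, hσ]) (by simp)]
    simp only [wt, burstWeight, true_and]
    split_ifs <;> simp
  intro ε hε
  set C : ℝ := ∑ _i : V, ∑ _j ∈ Finset.Icc 1 b, ∑ _ρ : {ρ : V → ℤ // ZRec A z ρ}, (1 : ℝ)
  have hC0 : 0 ≤ C := by positivity
  have hev : ∀ᶠ n in atTop, ∀ i ρ ρ₀, |(avgOp α (openStep hEul hConn z) ^ n) (wt i ρ) ρ₀ -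
      (∑ σ, wt i ρ σ) / κ| ≤ ε / (C + 1) := by
    simp only [eventually_all]
    intro i ρ ρ₀
    filter_upwards [Metric.tendsto_nhds.1 (hlim i ρ ρ₀) (ε / (C + 1)) (by positivity)] with n hn
    exact (Real.dist_eq _ _ ▸ hn).le
  obtain ⟨N, hN⟩ := eventually_atTop.1 hev
  refine ⟨-(N + b + 1 : ℤ), by omega, fun s0 hs0 => ?_⟩
  obtain ⟨ρ₀, hρ₀, hequiv⟩ := exists_sinkEquiv_zrec hEul hConn z s0
  rw [htarget, thresholdProb_burst_eq (ρ₀ := ⟨ρ₀, hρ₀⟩) hEul hConn α b hequiv (by omega)]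
  simp only [← Finset.sum_sub_distrib]
  calc _ ≤ ∑ _i : V, ∑ _j ∈ Finset.Icc 1 b, ∑ _ρ : {ρ : V → ℤ // ZRec A z ρ}, ε / (C + 1) := by
        refine (Finset.abs_sum_le_sum_abs _ _).trans (Finset.sum_le_sum fun i _ => ?_)
        refine (Finset.abs_sum_le_sum_abs _ _).trans (Finset.sum_le_sum fun j hj => ?_)
        refine (Finset.abs_sum_le_sum_abs _ _).trans (Finset.sum_le_sum fun ρ _ => ?_)
        refine hN _ ?_ i ρ _
        have h1 : 0 ≤ totalMass ρ.1 := Finset.sum_nonneg fun k _ => ρ.2.nonneg hEul k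
        have h2 := (Finset.mem_Icc.1 hj).2
        omega
    _ = C * (ε / (C + 1)) := by simp only [C, Finset.sum_mul, one_mul]
    _ ≤ ε := by
        rw [mul_div_assoc', div_le_iff₀ (by positivity)]
        nlinarith
end
end

section
/- (Markov Renewal Theorem) Suppose (X_k)_{k≥0} is an irreducible Markov chain on a finite state space with length function ℓ satisfying the gcd-1 aperiodicity condition. Then for any states x_0, x, y and any m ∈ ℕ, P_{x_0}{ (X_{τ_n − 1}, X_{τ_n}, λ_{τ_n} − n) = (x, y, m) } → (1/Z)·π(x)·P(x,y)·1{0 ≤ m ≤ ℓ(x,y) − 1} as n → ∞, where the normalizing constant is Z = Σ_{(x,y)∈E} π(x)·P(x,y)·ℓ(x,y). -/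
open scoped BigOperators
open Classical Filter

noncomputable section

namespace MarkovRenewal

variable {S : Type*} [Fintype S] [DecidableEq S]

/-- Probability of the trajectory `x, l₀, l₁, …` under the transition matrix `P`,
starting at `x`. -/
def pathProb (P : S → S → ℝ) : S → List S → ℝ
  | _, [] => 1
  | x, y :: l => P x y * pathProb P y l

/-- Total length of a path (sum of the lengths of its edges). -/
def pathLen (ℓ : S → S → ℕ) : S → List S → ℕ
  | _, [] => 0
  | x, y :: l => ℓ x y + pathLen ℓ y l

/-- `n`-step transition probabilities. -/
def iterP (P : S → S → ℝ) : ℕ → S → S → ℝ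
  | 0 => fun a b => if a = b then 1 else 0
  | n + 1 => fun a b => ∑ c, iterP P n a c * P c b

/-- `P` is a stochastic matrix. -/
def IsTransition (P : S → S → ℝ) : Prop :=
  (∀ a b, 0 ≤ P a b) ∧ ∀ a, ∑ b, P a b = 1

/-- Irreducibility: every state can be reached from every state. -/
def Irreducible (P : S → S → ℝ) : Prop := ∀ a b, ∃ n, 0 < iterP P n a b

/-- Aperiodicity: for each state `a`, `gcd {n ≥ 1 : Pⁿ(a,a) > 0} = 1`. -/
def Aperiodic (P : S → S → ℝ) : Prop :=
  ∀ a : S, ∀ d : ℕ, (∀ n : ℕ, 1 ≤ n → 0 < iterP P n a a → d ∣ n) → d = 1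

/-- `π` is a stationary distribution for `P`. -/
def Stationary (P : S → S → ℝ) (π : S → ℝ) : Prop :=
  (∀ a, 0 ≤ π a) ∧ (∑ a, π a = 1) ∧ ∀ b, ∑ a, π a * P a b = π b

end MarkovRenewal

namespace MarkovRenewal

section Reachability

/-- `b` can be reached from `a` by a path of total length `k` all of whose edges are open. -/
inductive Reach {S : Type*} (P : S → S → ℝ) (ℓ : S → S → ℕ) : S → S → ℕ → Prop
  | refl (a : S) : Reach P ℓ a a 0
  | step {a b c : S} {k : ℕ} : 0 < P a b → Reach P ℓ b c k → Reach P ℓ a c (ℓ a b + k)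

variable {S : Type*} {P : S → S → ℝ} {ℓ : S → S → ℕ}

lemma Reach.trans {a b c : S} {j k : ℕ} (h : Reach P ℓ a b j) (h' : Reach P ℓ b c k) :
    Reach P ℓ a c (j + k) := by
  induction h with
  | refl => simpa using h'
  | step hab _ ih => rw [add_assoc]; exact .step hab (ih h')

lemma reach_of_chain {a b : S} {l : List S} (h : List.IsChain (fun a b => 0 < P a b) (a :: l))
    (hl : (a :: l).getLast? = some b) : Reach P ℓ a b (pathLen ℓ a l) := by
  induction l generalizing a with
  | nil =>
    obtain rfl : a = b := by simpa using hl
    exact .refl a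
  | cons c l ih =>
    rw [List.isChain_cons_cons] at h
    rw [List.getLast?_cons_cons] at hl
    exact .step h.1 (ih h.2 hl)

/-- The gcd-1 condition on the lengths of closed paths. -/
def GcdOne (P : S → S → ℝ) (ℓ : S → S → ℕ) : Prop :=
  ∀ d : ℕ, (∀ (a : S) (k : ℕ), Reach P ℓ a a k → d ∣ k) → d = 1

lemma exists_length_ne_zero (hgcd : GcdOne P ℓ) : ∃ a b, 0 < P a b ∧ ℓ a b ≠ 0 := by
  by_contra! h
  have hzero : ∀ a b k, Reach P ℓ a b k → k = 0 := by
    intro a b k hk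
    induction hk with
    | refl => rfl
    | step hab _ ih => rw [h _ _ hab, ih]
  exact absurd (hgcd 2 fun a k hk => (hzero a a k hk) ▸ dvd_zero 2) (by norm_num)

variable [Fintype S] [DecidableEq S]

lemma exists_reach_of_iterP_pos (hP : IsTransition P) (n : ℕ) :
    ∀ {a b : S}, 0 < iterP P n a b → ∃ k, Reach P ℓ a b k := by
  induction n with
  | zero =>
    intro a b h
    by_cases hab : a = b
    · exact hab ▸ ⟨0, .refl a⟩
    · simp [iterP, hab] at h
  | succ n ih =>
    intro a b h
    obtain ⟨c, -, hc⟩ := Finset.exists_lt_of_sum_lt (s := Finset.univ)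
      (f := fun _ : S => (0 : ℝ)) (g := fun c => iterP P n a c * P c b) (by simpa [iterP] using h)
    have hcb : 0 < P c b := (hP.1 c b).lt_of_ne' fun h0 => by simp [h0] at hc
    obtain ⟨k, hk⟩ := ih (pos_of_mul_pos_left hc hcb.le)
    exact ⟨_, hk.trans (.step hcb (.refl b))⟩

lemma exists_reach (hP : IsTransition P) (hirr : Irreducible P) (ℓ : S → S → ℕ) (a b : S) :
    ∃ k, Reach P ℓ a b k :=
  let ⟨n, hn⟩ := hirr a b
  exists_reach_of_iterP_pos hP n hn

/-- Under the gcd-1 condition, all sufficiently long lengths are realized between two states. -/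
lemma exists_forall_reach (hP : IsTransition P) (hirr : Irreducible P) (hgcd : GcdOne P ℓ)
    (a b : S) : ∃ K, ∀ k ≥ K, Reach P ℓ a b k := by
  set s : Set ℕ := {k | Reach P ℓ a a k}
  have hone : Nat.setGcd s = 1 := by
    refine hgcd _ fun c k hk => ?_
    obtain ⟨i, hi⟩ := exists_reach hP hirr ℓ a c
    obtain ⟨j, hj⟩ := exists_reach hP hirr ℓ c a
    have hij : Nat.setGcd s ∣ i + j := Nat.setGcd_dvd_of_mem (hi.trans hj)
    have hikj : Nat.setGcd s ∣ k + (i + j) := by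
      rw [add_left_comm]
      exact Nat.setGcd_dvd_of_mem (hi.trans (hk.trans hj))
    exact (Nat.dvd_add_left hij).1 hikj
  have hcl : AddSubmonoid.closure s ≤
      { carrier := s, zero_mem' := .refl a, add_mem' := fun h h' => Reach.trans h h' } :=
    AddSubmonoid.closure_le.2 fun _ h => h
  obtain ⟨n, hn⟩ := Nat.exists_mem_closure_of_ge s
  obtain ⟨j, hj⟩ := exists_reach hP hirr ℓ a b
  refine ⟨n + j, fun k hk => ?_⟩
  have := Reach.trans (hcl (hn (k - j) (by omega) (hone ▸ one_dvd _))) hj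
  rwa [Nat.sub_add_cancel (by omega)] at this

lemma Stationary.pos {π : S → ℝ} (hP : IsTransition P) (hirr : Irreducible P)
    (hπ : Stationary P π) (b : S) : 0 < π b := by
  have hstep : ∀ a b k, Reach P (fun _ _ => 0) a b k → 0 < π a → 0 < π b := by
    intro a b k hk
    induction hk with
    | refl => exact id
    | @step a b c k hab _ ih =>
      intro ha
      refine ih ?_
      rw [← hπ.2.2 b]
      exact Finset.sum_pos' (fun c _ => mul_nonneg (hπ.1 c) (hP.1 c b))
        ⟨a, Finset.mem_univ a, mul_pos ha hab⟩
  obtain ⟨a, -, ha⟩ := Finset.exists_lt_of_sum_lt (s := Finset.univ)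
    (f := fun _ : S => (0 : ℝ)) (g := π) (by simp [hπ.2.1])
  obtain ⟨k, hk⟩ := exists_reach hP hirr (fun _ _ => 0) a b
  exact hstep a b k hk ha

lemma meanLength_pos {π : S → ℝ} (hP : IsTransition P) (hirr : Irreducible P)
    (hπ : Stationary P π) (hgcd : GcdOne P ℓ) :
    0 < ∑ a, ∑ b, π a * P a b * (ℓ a b : ℝ) := by
  obtain ⟨a, b, hab, hl⟩ := exists_length_ne_zero hgcd
  have hnn : ∀ c d, 0 ≤ π c * P c d * (ℓ c d : ℝ) := fun c d =>
    mul_nonneg (mul_nonneg (hπ.1 c) (hP.1 c d)) (Nat.cast_nonneg _)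
  refine Finset.sum_pos' (fun c _ => Finset.sum_nonneg fun d _ => hnn c d)
    ⟨a, Finset.mem_univ a, Finset.sum_pos' (fun d _ => hnn a d) ⟨b, Finset.mem_univ b, ?_⟩⟩
  have := hπ.pos hP hirr a
  have : (0 : ℝ) < ℓ a b := by positivity
  positivity

end Reachability

section Renewal

variable {S : Type*} [Fintype S] {P : S → S → ℝ} {ℓ : S → S → ℕ} {π : S → ℝ}

/-- The linear functional that is conserved by the renewal recursion
`h N a = ∑ b, P a b * h (N - ℓ a b) b`. -/
def conserved (P : S → S → ℝ) (ℓ : S → S → ℕ) (π : S → ℝ) (h : ℤ → S → ℝ) (N : ℤ) : ℝ :=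
  ∑ a, ∑ b, π a * P a b * ∑ i ∈ Finset.range (ℓ a b), h (N - i) b

lemma conserved_sub_conserved (hπ : Stationary P π) (h : ℤ → S → ℝ)
    (N : ℤ) : conserved P ℓ π h N - conserved P ℓ π h (N - 1) =
      ∑ a, π a * (h N a - ∑ b, P a b * h (N - ℓ a b) b) := by
  have htel : ∀ a b, (∑ i ∈ Finset.range (ℓ a b), h (N - i) b) -
      ∑ i ∈ Finset.range (ℓ a b), h (N - 1 - i) b = h N b - h (N - ℓ a b) b := by
    intro a b
    rw [← Finset.sum_sub_distrib]
    have := Finset.sum_range_sub' (fun i : ℕ => h (N - i) b) (ℓ a b)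
    simp only [Nat.cast_zero, sub_zero] at this
    rw [← this]
    refine Finset.sum_congr rfl fun i _ => ?_
    rw [Nat.cast_succ, add_comm (i : ℤ) 1, sub_sub]
  simp only [conserved, ← Finset.sum_sub_distrib, ← mul_sub, htel]
  simp only [mul_sub, Finset.sum_sub_distrib, Finset.mul_sum, mul_assoc]
  congr 1
  rw [Finset.sum_comm]
  refine Finset.sum_congr rfl fun b _ => ?_
  simp only [← mul_assoc]
  rw [← Finset.sum_mul, hπ.2.2]

lemma conserved_neg (h : ℤ → S → ℝ) (N : ℤ) :
    conserved P ℓ π (-h) N = -conserved P ℓ π h N := by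
  simp [conserved]

variable [DecidableEq S]

/-- A bounded solution of the renewal recursion has no cluster point above the value prescribed
by the conserved functional. -/
lemma mapClusterPt_le (hP : IsTransition P) (hirr : Irreducible P)
    (hπ : Stationary P π) (hgcd : GcdOne P ℓ) {h : ℤ → S → ℝ} {C q : ℝ}
    (hC : ∀ N a, |h N a| ≤ C)
    (hrec : ∀ᶠ N in atTop, ∀ a, h N a = ∑ b, P a b * h (N - ℓ a b) b)
    (hq : ∀ᶠ N in atTop, conserved P ℓ π h N = q) {a₀ : S} {v : ℝ}
    (hv : MapClusterPt v atTop fun N => h N a₀) :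
    v ≤ q / ∑ a, ∑ b, π a * P a b * (ℓ a b : ℝ) := by
  set K : Set ℝ := ⋃ a, {u | MapClusterPt u atTop fun N => h N a}
  have hIcc : ∀ N a, h N a ∈ Set.Icc (-C) C := fun N a => abs_le.1 (hC N a)
  have hclosed : IsClosed K :=
    isClosed_iUnion_of_finite fun a => isClosed_setOfPred_clusterPt
  have hsub : K ⊆ Set.Icc (-C) C := by
    intro u hu
    obtain ⟨a, ha⟩ := Set.mem_iUnion.1 hu
    obtain ⟨𝒰, -, h𝒰⟩ := mapClusterPt_iff_ultrafilter.1 ha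
    exact isClosed_Icc.mem_of_tendsto h𝒰 (Eventually.of_forall fun N => hIcc N a)
  have hvK : v ∈ K := Set.mem_iUnion.2 ⟨a₀, hv⟩
  obtain ⟨M, hMK, hM⟩ :=
    (isCompact_Icc.of_isClosed_subset hclosed hsub).exists_isGreatest ⟨v, hvK⟩
  refine (hM hvK).trans ?_
  obtain ⟨a₁, ha₁⟩ := Set.mem_iUnion.1 hMK
  obtain ⟨𝒰, h𝒰, ha₁⟩ := mapClusterPt_iff_ultrafilter.1 ha₁
  have hlim : ∀ (j : ℤ) (b : S), ∃ u, Tendsto (fun N => h (N + j) b) 𝒰 (nhds u) := by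
    intro j b
    obtain ⟨u, -, hu⟩ := (isCompact_Icc (a := -C) (b := C)).ultrafilter_le_nhds'
      (𝒰.map fun N => h (N + j) b) (Eventually.of_forall fun N => hIcc (N + j) b :
        ∀ᶠ N in (𝒰 : Filter ℤ), h (N + j) b ∈ Set.Icc (-C) C)
    exact ⟨u, hu⟩
  choose g hg using hlim
  have hshift : ∀ j : ℤ, Tendsto (fun N : ℤ => N + j) 𝒰 atTop := fun j =>
    (tendsto_atTop_add_const_right _ j tendsto_id).mono_left h𝒰
  have hgM : ∀ j b, g j b ≤ M := by
    intro j b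
    refine hM (Set.mem_iUnion.2 ⟨b, ?_⟩)
    exact MapClusterPt.of_comp (hshift j) (hg j b).mapClusterPt
  have hgrec : ∀ j a, g j a = ∑ b, P a b * g (j - ℓ a b) b := by
    intro j a
    refine tendsto_nhds_unique_of_eventuallyEq (hg j a)
      (tendsto_finsetSum _ fun b _ => (hg (j - ℓ a b) b).const_mul (P a b)) ?_
    filter_upwards [(hshift j).eventually hrec] with N hN
    rw [hN a]
    simp only [add_sub_assoc]
  have hprop : ∀ a b k, Reach P ℓ a b k → ∀ j, g j a = M → g (j - k) b = M := by
    intro a b k hk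
    induction hk with
    | refl => simp
    | @step a b c k hab _ ih =>
      intro j hj
      have hb : g (j - ℓ a b) b = M := by
        by_contra hne
        have hlt : ∑ c, P a c * g (j - ℓ a c) c < ∑ c, P a c * M :=
          Finset.sum_lt_sum (fun c _ => mul_le_mul_of_nonneg_left (hgM _ _) (hP.1 a c))
            ⟨b, Finset.mem_univ b, mul_lt_mul_of_pos_left ((hgM _ _).lt_of_ne hne) hab⟩
        rw [← Finset.sum_mul, hP.2, one_mul, ← hgrec, hj] at hlt
        exact hlt.false
      rw [Nat.cast_add, ← sub_sub]
      exact ih _ hb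
  have h0 : g 0 a₁ = M := tendsto_nhds_unique (by simpa using hg 0 a₁) ha₁
  choose k hk using fun b => exists_forall_reach hP hirr hgcd a₁ b
  set L := ∑ b, k b
  have hconst : ∀ b (i : ℕ), g (-(L : ℤ) - i) b = M := by
    intro b i
    have hle : k b ≤ L := Finset.single_le_sum (fun _ _ => Nat.zero_le _) (Finset.mem_univ b)
    have := hprop a₁ b _ (hk b (L + i) (by omega)) 0 h0
    rwa [Nat.cast_add, zero_sub, neg_add'] at this
  have hgq : conserved P ℓ π g (-(L : ℤ)) = q := by
    have ht : Tendsto (fun N => conserved P ℓ π h (N + -(L : ℤ))) 𝒰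
        (nhds (conserved P ℓ π g (-(L : ℤ)))) := by
      simp only [conserved, add_sub_assoc]
      exact tendsto_finsetSum _ fun a _ => tendsto_finsetSum _ fun b _ =>
        (tendsto_finsetSum _ fun i _ => hg _ b).const_mul _
    exact tendsto_nhds_unique_of_eventuallyEq ht tendsto_const_nhds
      ((hshift _).eventually hq)
  rw [le_div_iff₀ (meanLength_pos hP hirr hπ hgcd), ← hgq]
  simp only [conserved, hconst, Finset.sum_const, Finset.card_range, nsmul_eq_mul]
  rw [Finset.mul_sum]
  refine (Finset.sum_congr rfl fun a _ => ?_).le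
  rw [Finset.mul_sum]
  exact Finset.sum_congr rfl fun b _ => by ring

/-- A bounded solution of the renewal recursion converges to the value prescribed by the
conserved functional. -/
theorem tendsto_of_renewal (hP : IsTransition P) (hirr : Irreducible P)
    (hπ : Stationary P π) (hgcd : GcdOne P ℓ) {h : ℤ → S → ℝ} {C q : ℝ}
    (hC : ∀ N a, |h N a| ≤ C)
    (hrec : ∀ᶠ N in atTop, ∀ a, h N a = ∑ b, P a b * h (N - ℓ a b) b)
    (hq : ∀ᶠ N in atTop, conserved P ℓ π h N = q) (a : S) :
    Tendsto (fun N => h N a) atTop (nhds (q / ∑ a, ∑ b, π a * P a b * (ℓ a b : ℝ))) := by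
  refine (isCompact_Icc (a := -C) (b := C)).tendsto_nhds_of_unique_mapClusterPt
    (Eventually.of_forall fun N => abs_le.1 (hC N a)) fun v _ hv => le_antisymm
      (mapClusterPt_le hP hirr hπ hgcd hC hrec hq hv) ?_
  have := mapClusterPt_le hP hirr hπ hgcd (h := -h) (q := -q) (v := -v) (a₀ := a)
    (by simpa using hC) ?_ ?_ ?_
  · rw [neg_div] at this
    exact neg_le_neg_iff.1 this
  · filter_upwards [hrec] with N hN a
    simp [hN a]
  · filter_upwards [hq] with N hN
    rw [conserved_neg, hN]
  · exact hv.continuousAt_comp continuous_neg.continuousAt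

end Renewal

section GreenFunction

variable {S : Type*} {P : S → S → ℝ} {ℓ : S → S → ℕ}

lemma pathProb_nonneg (hP : ∀ a b, 0 ≤ P a b) (a : S) (l : List S) : 0 ≤ pathProb P a l := by
  induction l generalizing a with
  | nil => exact zero_le_one
  | cons b l ih => exact mul_nonneg (hP a b) (ih b)

lemma pathProb_append_singleton {a b : S} {l : List S} (h : (a :: l).getLast? = some b) (c : S) :
    pathProb P a (l ++ [c]) = pathProb P a l * P b c := by
  induction l generalizing a with
  | nil =>
    obtain rfl : a = b := by simpa using h
    simp [pathProb]
  | cons d l ih =>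
    rw [List.getLast?_cons_cons] at h
    simp only [List.cons_append, pathProb, ih h, mul_assoc]

lemma pathLen_append_singleton {a b : S} {l : List S} (h : (a :: l).getLast? = some b) (c : S) :
    pathLen ℓ a (l ++ [c]) = pathLen ℓ a l + ℓ b c := by
  induction l generalizing a with
  | nil =>
    obtain rfl : a = b := by simpa using h
    simp [pathLen]
  | cons d l ih =>
    rw [List.getLast?_cons_cons] at h
    simp only [List.cons_append, pathLen, ih h, add_assoc]

lemma pathLen_mono {l l' : List S} (h : l <+: l') (a : S) : pathLen ℓ a l ≤ pathLen ℓ a l' := by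
  induction l generalizing a l' with
  | nil => exact Nat.zero_le _
  | cons b l ih =>
    obtain ⟨t, rfl⟩ := h
    exact Nat.add_le_add_left (ih (List.prefix_append l t) b) _

/-- The probability of the path `l` from `a`, counted only if it ends in `x` at length `N`. -/
def pathWeight (P : S → S → ℝ) (ℓ : S → S → ℕ) (x : S) (N : ℤ) (a : S) (l : List S) : ℝ :=
  if (a :: l).getLast? = some x ∧ (pathLen ℓ a l : ℤ) = N then pathProb P a l else 0

lemma pathWeight_nonneg (hP : ∀ a b, 0 ≤ P a b) (x : S) (N : ℤ) (a : S) (l : List S) :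
    0 ≤ pathWeight P ℓ x N a l := by
  rw [pathWeight]
  split_ifs
  exacts [pathProb_nonneg hP a l, le_rfl]

lemma pathWeight_nil [DecidableEq S] (x : S) (N : ℤ) (a : S) :
    pathWeight P ℓ x N a [] = if a = x ∧ N = 0 then 1 else 0 := by
  simp [pathWeight, pathLen, pathProb, eq_comm (a := (0 : ℤ))]

lemma pathWeight_cons (x : S) (N : ℤ) (a b : S) (l : List S) :
    pathWeight P ℓ x N a (b :: l) = P a b * pathWeight P ℓ x (N - ℓ a b) b l := by
  simp only [pathWeight, List.getLast?_cons_cons, pathLen, pathProb, Nat.cast_add,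
    eq_sub_iff_add_eq', mul_ite, mul_zero]

lemma pathWeight_of_neg {x : S} {N : ℤ} (hN : N < 0) (a : S) (l : List S) :
    pathWeight P ℓ x N a l = 0 :=
  if_neg fun h => by omega

/-- The expected number of visits to `x` at length `N`, for the chain started at `a`. -/
def green (P : S → S → ℝ) (ℓ : S → S → ℕ) (x : S) (N : ℤ) (a : S) : ℝ :=
  ∑' l, pathWeight P ℓ x N a l

lemma green_of_neg {x : S} {N : ℤ} (hN : N < 0) (a : S) : green P ℓ x N a = 0 := by
  simp [green, pathWeight_of_neg hN]

variable [Fintype S]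

/-- The finite set of lists with fewer than `n` entries. -/
def listsBelow (S : Type*) [Fintype S] : ℕ → Finset (List S)
  | 0 => ∅
  | n + 1 => insert [] (Finset.univ.biUnion fun b => (listsBelow S n).image (List.cons b))

lemma mem_listsBelow {n : ℕ} {l : List S} : l ∈ listsBelow S n ↔ l.length < n := by
  induction n generalizing l with
  | zero => simp [listsBelow]
  | succ n ih => cases l <;> simp [listsBelow, ih]

lemma sum_listsBelow_succ (n : ℕ) (F : List S → ℝ) :
    ∑ l ∈ listsBelow S (n + 1), F l = F [] + ∑ b, ∑ l ∈ listsBelow S n, F (b :: l) := by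
  rw [listsBelow, Finset.sum_insert (by simp), Finset.sum_biUnion]
  · congr 1
    exact Finset.sum_congr rfl fun b _ => Finset.sum_image fun _ _ _ _ h => List.cons_injective h
  · intro b _ c _ hbc
    rw [Function.onFun, Finset.disjoint_left]
    intro l hb hc
    obtain ⟨t, -, rfl⟩ := Finset.mem_image.1 hb
    obtain ⟨u, -, hu⟩ := Finset.mem_image.1 hc
    exact hbc (List.cons.inj hu).1.symm

lemma tendsto_listsBelow : Tendsto (listsBelow S) atTop atTop :=
  tendsto_atTop_finset_of_monotone
    (fun _ _ hmn _ hl => mem_listsBelow.2 ((mem_listsBelow.1 hl).trans_le hmn))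
    fun l => ⟨l.length + 1, mem_listsBelow.2 (Nat.lt_succ_self _)⟩

lemma sum_pathWeight_succ [DecidableEq S] (x : S) (N : ℤ) (a : S) (n : ℕ) :
    ∑ l ∈ listsBelow S (n + 1), pathWeight P ℓ x N a l = (if a = x ∧ N = 0 then 1 else 0) +
      ∑ b, P a b * ∑ l ∈ listsBelow S n, pathWeight P ℓ x (N - ℓ a b) b l := by
  simp only [sum_listsBelow_succ, pathWeight_nil, pathWeight_cons, Finset.mul_sum]

/-- The probability that the first `k` edges of the chain from `a` all have length zero. -/
def zeroProb (P : S → S → ℝ) (ℓ : S → S → ℕ) : ℕ → S → ℝ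
  | 0, _ => 1
  | k + 1, a => ∑ b, if ℓ a b = 0 then P a b * zeroProb P ℓ k b else 0

lemma zeroProb_nonneg (hP : IsTransition P) (k : ℕ) (a : S) : 0 ≤ zeroProb P ℓ k a := by
  induction k generalizing a with
  | zero => exact zero_le_one
  | succ k ih =>
    refine Finset.sum_nonneg fun b _ => ?_
    split_ifs
    exacts [mul_nonneg (hP.1 a b) (ih b), le_rfl]

lemma zeroProb_antitone (hP : IsTransition P) (a : S) : Antitone fun k => zeroProb P ℓ k a := by
  refine antitone_nat_of_succ_le fun k => ?_
  induction k generalizing a with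
  | zero =>
    rw [zeroProb, zeroProb, ← hP.2 a]
    refine Finset.sum_le_sum fun b _ => ?_
    split_ifs
    exacts [(mul_one _).le, hP.1 a b]
  | succ k ih =>
    refine Finset.sum_le_sum fun b _ => ?_
    split_ifs
    exacts [mul_le_mul_of_nonneg_left (ih b) (hP.1 a b), le_rfl]

lemma zeroProb_le_one (hP : IsTransition P) (k : ℕ) (a : S) : zeroProb P ℓ k a ≤ 1 :=
  zeroProb_antitone hP a (Nat.zero_le k)

lemma zeroProb_eq_one_of_succ (hP : IsTransition P) {k : ℕ} {a b : S} (hab : 0 < P a b)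
    (h : zeroProb P ℓ (k + 1) a = 1) : ℓ a b = 0 ∧ zeroProb P ℓ k b = 1 := by
  have hle : ∀ c ∈ Finset.univ, (if ℓ a c = 0 then P a c * zeroProb P ℓ k c else 0) ≤ P a c := by
    intro c _
    split_ifs
    exacts [mul_le_of_le_one_right (hP.1 a c) (zeroProb_le_one hP k c), hP.1 a c]
  have heq := (Finset.sum_eq_sum_iff_of_le hle).1 (h.trans (hP.2 a).symm) b (Finset.mem_univ b)
  split_ifs at heq with hl
  · exact ⟨hl, by simpa [hab.ne'] using heq⟩
  · exact absurd heq hab.ne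

variable [DecidableEq S]

lemma exists_zeroProb_lt_one (hP : IsTransition P) (hirr : Irreducible P) (hgcd : GcdOne P ℓ)
    (a : S) : ∃ k, zeroProb P ℓ k a < 1 := by
  by_contra! h
  have hone : ∀ a b k, Reach P ℓ a b k → (∀ k, zeroProb P ℓ k a = 1) →
      ∀ k, zeroProb P ℓ k b = 1 := by
    intro a b k hk
    induction hk with
    | refl => exact id
    | step hab _ ih => exact fun ha => ih fun k => (zeroProb_eq_one_of_succ hP hab (ha (k + 1))).2
  obtain ⟨b, c, hbc, hl⟩ := exists_length_ne_zero hgcd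
  obtain ⟨k, hk⟩ := exists_reach hP hirr ℓ a b
  have hb := hone a b k hk fun k => (zeroProb_le_one hP k a).antisymm (h k)
  exact hl (zeroProb_eq_one_of_succ hP hbc (hb 1)).1

/-- There is a nonnegative function that decreases by at least one along zero-length edges,
on average. -/
lemma exists_superharmonic (hP : IsTransition P) (hirr : Irreducible P) (hgcd : GcdOne P ℓ) :
    ∃ v : S → ℝ, (∀ a, 0 ≤ v a) ∧
      ∀ a, 1 + ∑ b, (if ℓ a b = 0 then P a b * v b else 0) ≤ v a := by
  choose k hk using exists_zeroProb_lt_one hP hirr hgcd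
  set K := ∑ a, k a
  have hK : ∀ a, zeroProb P ℓ K a < 1 := fun a =>
    (zeroProb_antitone hP a (Finset.single_le_sum (fun _ _ => Nat.zero_le _)
      (Finset.mem_univ a))).trans_lt (hk a)
  obtain ⟨ε, hε, hKε⟩ : ∃ ε > 0, ∀ a, ε ≤ 1 - zeroProb P ℓ K a := by
    cases isEmpty_or_nonempty S
    · exact ⟨1, one_pos, isEmptyElim⟩
    · obtain ⟨a, ha⟩ := Finite.exists_max (zeroProb P ℓ K)
      exact ⟨1 - zeroProb P ℓ K a, sub_pos.2 (hK a), fun b => sub_le_sub_left (ha b) 1⟩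
  refine ⟨fun a => ε⁻¹ * ∑ j ∈ Finset.range K, zeroProb P ℓ j a, fun a =>
    mul_nonneg (inv_nonneg.2 hε.le) (Finset.sum_nonneg fun j _ => zeroProb_nonneg hP j a),
    fun a => ?_⟩
  have hshift : ∑ b, (if ℓ a b = 0 then
        P a b * (ε⁻¹ * ∑ j ∈ Finset.range K, zeroProb P ℓ j b) else 0) =
      ε⁻¹ * ∑ j ∈ Finset.range K, zeroProb P ℓ (j + 1) a := by
    simp only [zeroProb]
    rw [Finset.sum_comm, Finset.mul_sum]
    refine Finset.sum_congr rfl fun b _ => ?_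
    split_ifs
    · rw [← Finset.mul_sum]; ring
    · simp
  have htel := Finset.sum_range_sub' (fun j => zeroProb P ℓ j a) K
  rw [Finset.sum_sub_distrib] at htel
  have hdiff : 1 ≤ ε⁻¹ * (∑ j ∈ Finset.range K, zeroProb P ℓ j a -
      ∑ j ∈ Finset.range K, zeroProb P ℓ (j + 1) a) := by
    rw [htel, inv_mul_eq_div, one_le_div hε]
    exact hKε a
  rw [hshift]
  linarith

/-- The truncated Green functions are uniformly bounded. -/
lemma exists_sum_pathWeight_le (hP : IsTransition P) (hirr : Irreducible P) (hgcd : GcdOne P ℓ)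
    (x : S) : ∃ C, ∀ n N a, ∑ l ∈ listsBelow S n, pathWeight P ℓ x N a l ≤ C := by
  obtain ⟨v, hv0, hv⟩ := exists_superharmonic hP hirr hgcd
  have hzero : ∀ n a, ∑ l ∈ listsBelow S n, pathWeight P ℓ x 0 a l ≤ v a := by
    intro n
    induction n with
    | zero => simpa [listsBelow] using hv0
    | succ n ih =>
      intro a
      rw [sum_pathWeight_succ]
      refine le_trans (add_le_add ?_ (Finset.sum_le_sum fun b _ => ?_)) (hv a)
      · split_ifs <;> norm_num
      · split_ifs with hl
        · simpa [hl] using mul_le_mul_of_nonneg_left (ih b) (hP.1 a b)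
        · have hneg : (0 : ℤ) - ℓ a b < 0 := by omega
          simp only [pathWeight_of_neg hneg, Finset.sum_const_zero, mul_zero, le_refl]
  have hvC : ∀ a, v a ≤ ∑ b, v b := fun a =>
    Finset.single_le_sum (fun b _ => hv0 b) (Finset.mem_univ a)
  have hC0 : 0 ≤ ∑ b, v b := Finset.sum_nonneg fun b _ => hv0 b
  refine ⟨∑ b, v b, fun n => ?_⟩
  induction n with
  | zero => simpa [listsBelow] using fun _ : S => hC0
  | succ n ih =>
    intro N a
    by_cases hN : N = 0
    · exact hN ▸ (hzero _ a).trans (hvC a)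
    · rw [sum_pathWeight_succ, if_neg (fun h => hN h.2), zero_add]
      calc _ ≤ ∑ b, P a b * ∑ c, v c :=
            Finset.sum_le_sum fun b _ => mul_le_mul_of_nonneg_left (ih _ b) (hP.1 a b)
        _ = _ := by rw [← Finset.sum_mul, hP.2, one_mul]

lemma exists_forall_sum_pathWeight_le (hP : IsTransition P) (hirr : Irreducible P)
    (hgcd : GcdOne P ℓ) (x : S) :
    ∃ C, ∀ N a (s : Finset (List S)), ∑ l ∈ s, pathWeight P ℓ x N a l ≤ C := by
  obtain ⟨C, hC⟩ := exists_sum_pathWeight_le hP hirr hgcd x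
  refine ⟨C, fun N a s => ?_⟩
  obtain ⟨n, hn⟩ := (tendsto_listsBelow.eventually_ge_atTop s).exists
  exact (Finset.sum_le_sum_of_subset_of_nonneg hn
    fun l _ _ => pathWeight_nonneg hP.1 x N a l).trans (hC n N a)

lemma summable_pathWeight (hP : IsTransition P) (hirr : Irreducible P) (hgcd : GcdOne P ℓ)
    (x : S) (N : ℤ) (a : S) : Summable (pathWeight P ℓ x N a) :=
  let ⟨_, hC⟩ := exists_forall_sum_pathWeight_le hP hirr hgcd x
  summable_of_sum_le (pathWeight_nonneg hP.1 x N a) (hC N a)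

lemma exists_abs_green_le (hP : IsTransition P) (hirr : Irreducible P) (hgcd : GcdOne P ℓ)
    (x : S) : ∃ C, ∀ N a, |green P ℓ x N a| ≤ C := by
  obtain ⟨C, hC⟩ := exists_forall_sum_pathWeight_le hP hirr hgcd x
  refine ⟨C, fun N a => ?_⟩
  rw [green, abs_of_nonneg (tsum_nonneg (pathWeight_nonneg hP.1 x N a))]
  exact (summable_pathWeight hP hirr hgcd x N a).tsum_le_of_sum_le (hC N a)

lemma green_eq (hP : IsTransition P) (hirr : Irreducible P) (hgcd : GcdOne P ℓ)
    (x : S) (N : ℤ) (a : S) :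
    green P ℓ x N a = (if a = x ∧ N = 0 then 1 else 0) +
      ∑ b, P a b * green P ℓ x (N - ℓ a b) b := by
  have hlim : ∀ N a, Tendsto (fun n => ∑ l ∈ listsBelow S n, pathWeight P ℓ x N a l) atTop
      (nhds (green P ℓ x N a)) := fun N a =>
    (summable_pathWeight hP hirr hgcd x N a).hasSum.comp tendsto_listsBelow
  refine tendsto_nhds_unique ((hlim N a).comp (tendsto_add_atTop_nat 1)) ?_
  simp only [Function.comp_def, sum_pathWeight_succ]
  exact tendsto_const_nhds.add (tendsto_finsetSum _ fun b _ => (hlim _ b).const_mul _)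

lemma conserved_green {π : S → ℝ} (hP : IsTransition P) (hirr : Irreducible P)
    (hπ : Stationary P π) (hgcd : GcdOne P ℓ) (x : S) (n : ℕ) :
    conserved P ℓ π (green P ℓ x) n = π x := by
  have hstep : ∀ N : ℤ, conserved P ℓ π (green P ℓ x) N -
      conserved P ℓ π (green P ℓ x) (N - 1) = if N = 0 then π x else 0 := by
    intro N
    rw [conserved_sub_conserved hπ]
    have : ∀ a, green P ℓ x N a - ∑ b, P a b * green P ℓ x (N - ℓ a b) b =
        if a = x ∧ N = 0 then 1 else 0 := fun a => by
      rw [green_eq hP hirr hgcd x N a, add_sub_cancel_right]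
    simp only [this]
    by_cases hN : N = 0 <;> simp [hN]
  induction n with
  | zero =>
    have hneg : conserved P ℓ π (green P ℓ x) (0 - 1) = 0 := by
      refine Finset.sum_eq_zero fun a _ => Finset.sum_eq_zero fun b _ => ?_
      rw [Finset.sum_eq_zero fun i _ => green_of_neg (by omega) b, mul_zero]
    simpa only [hneg, sub_zero, if_true, Nat.cast_zero] using hstep 0
  | succ n ih =>
    have := hstep (n + 1)
    rw [if_neg (by omega), add_sub_cancel_right, ih, sub_eq_zero] at this
    exact_mod_cast this

/-- The Green function converges to the stationary density of visits per unit length. -/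
theorem tendsto_green {π : S → ℝ} (hP : IsTransition P) (hirr : Irreducible P)
    (hπ : Stationary P π) (hgcd : GcdOne P ℓ) (x a : S) :
    Tendsto (fun N => green P ℓ x N a) atTop
      (nhds (π x / ∑ a, ∑ b, π a * P a b * (ℓ a b : ℝ))) := by
  obtain ⟨C, hC⟩ := exists_abs_green_le hP hirr hgcd x
  refine tendsto_of_renewal hP hirr hπ hgcd hC ?_ ?_ a
  · filter_upwards [eventually_gt_atTop 0] with N hN a
    rw [green_eq hP hirr hgcd x N a, if_neg fun h => hN.ne' h.2, zero_add]
  · filter_upwards [eventually_ge_atTop 0] with N hN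
    lift N to ℕ using hN
    exact conserved_green hP hirr hπ hgcd x N

end GreenFunction

section Overshoot

variable {S : Type*} {P : S → S → ℝ} {ℓ : S → S → ℕ}

lemma forall_prefix_pathLen_lt_iff {a c : S} {l : List S} {n : ℕ} :
    (∀ w, w <+: l ++ [c] → w ≠ l ++ [c] → pathLen ℓ a w < n) ↔ pathLen ℓ a l < n := by
  refine ⟨fun h => h l (List.prefix_append l [c]) (by simp), fun h w hw hne => ?_⟩
  exact (pathLen_mono ((List.prefix_concat_iff.1 hw).resolve_left hne) a).trans_lt h

/-- The trajectories that cross level `n` along the edge `(x, y)` with overshoot `m` are the paths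
that end in `x` at length `n + m - ℓ x y`, followed by this edge. -/
lemma tsum_crossing_eq [DecidableEq S] (a x y : S) (m n : ℕ) :
    (∑' w : List S,
      if (n ≤ pathLen ℓ a w ∧ (∀ w' : List S, w' <+: w → w' ≠ w → pathLen ℓ a w' < n) ∧
          (a :: w).dropLast.getLast? = some x ∧ w.getLast? = some y ∧ pathLen ℓ a w = n + m)
      then pathProb P a w else 0) =
    if m < ℓ x y then green P ℓ x ((n : ℤ) + (m - ℓ x y)) a * P x y else 0 := by
  rw [← (List.append_left_injective [y]).tsum_eq]
  · have hterm : ∀ l : List S,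
        (if (n ≤ pathLen ℓ a (l ++ [y]) ∧
            (∀ w' : List S, w' <+: l ++ [y] → w' ≠ l ++ [y] → pathLen ℓ a w' < n) ∧
            (a :: (l ++ [y])).dropLast.getLast? = some x ∧ (l ++ [y]).getLast? = some y ∧
            pathLen ℓ a (l ++ [y]) = n + m)
          then pathProb P a (l ++ [y]) else 0) =
        if m < ℓ x y then pathWeight P ℓ x ((n : ℤ) + (m - ℓ x y)) a l * P x y else 0 := by
      intro l
      rw [forall_prefix_pathLen_lt_iff, ← List.cons_append, List.dropLast_concat, pathWeight]
      by_cases hl : (a :: l).getLast? = some x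
      · simp only [pathLen_append_singleton hl, pathProb_append_singleton hl, hl,
          List.getLast?_concat, true_and]
        split_ifs <;> first | rfl | omega | simp
      · simp [hl]
    simp only [hterm]
    split_ifs
    · rw [tsum_mul_right, green]
    · exact tsum_zero
  · intro w hw
    have hy : w.getLast? = some y := by
      by_contra hne
      simp [hne] at hw
    exact ⟨w.dropLast, List.dropLast_append_getLast? y hy⟩

end Overshoot

end MarkovRenewal

open MarkovRenewal in
/-- **Markov Renewal Theorem.** For an irreducible finite Markov chain with
length function `ℓ` satisfying the gcd-1 aperiodicity condition on closed
paths, the law of `(X_{τ_n - 1}, X_{τ_n}, λ_{τ_n} - n)` converges, as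
`n → ∞`, to `(1/Z)·π(x)·P(x,y)·1{0 ≤ m ≤ ℓ(x,y) - 1}` with
`Z = Σ_{(x,y)} π(x)·P(x,y)·ℓ(x,y)`.  The probability is written as a sum,
over the (disjoint) cylinders of the trajectories `w` with `τ_n = |w|`
realizing the event, of the trajectory probabilities. -/
theorem statement_11 {S : Type*} [Fintype S] [DecidableEq S]
    (P : S → S → ℝ) (hP : IsTransition P) (hirr : MarkovRenewal.Irreducible P)
    (π : S → ℝ) (hπ : Stationary P π)
    (ℓ : S → S → ℕ)
    (hgcd : ∀ d : ℕ,
      (∀ (x : S) (l : List S), List.Chain (fun a b => 0 < P a b) x l → l ≠ [] →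
        l.getLast? = some x → d ∣ pathLen ℓ x l) → d = 1)
    (x0 x y : S) (m : ℕ) :
    Filter.Tendsto
      (fun n : ℕ =>
        ∑' w : List S,
          if (n ≤ pathLen ℓ x0 w ∧
              (∀ w' : List S, w' <+: w → w' ≠ w → pathLen ℓ x0 w' < n) ∧
              (x0 :: w).dropLast.getLast? = some x ∧ w.getLast? = some y ∧
              pathLen ℓ x0 w = n + m)
          then pathProb P x0 w else 0)
      Filter.atTop
      (nhds ((1 / (∑ a : S, ∑ b : S, π a * P a b * (ℓ a b : ℝ)))
        * (π x * P x y) * (if m < ℓ x y then 1 else 0))) := by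
  have hgcd' : GcdOne P ℓ := fun d hd => hgcd d fun a l hl _ ha => by
    refine hd a _ (reach_of_chain hl ?_)
    rw [List.getLast?_cons, ha, Option.getD_some]
  simp only [tsum_crossing_eq]
  split_ifs
  · have hlim := ((tendsto_green hP hirr hπ hgcd' x x0).comp
      (tendsto_atTop_add_const_right _ ((m : ℤ) - ℓ x y)
        (tendsto_natCast_atTop_atTop (R := ℤ)))).mul_const (P x y)
    convert hlim using 2
    · rfl
    · ring
  · rw [mul_zero]
    exact tendsto_const_nhds
end
end
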